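/- For every integer d ≥ 2, the language L_d^(≤) = {a₁^{n₁} a₂^{n₂} ⋯ a_d^{n_d} b₁^{m₁} b₂^{m₂} ⋯ b_d^{m_d} : nᵢ ≤ mᵢ for all i ∈ [d]} over the alphabet {a₁,...,a_d, b₁,...,b_d} belongs to DCFL(d) but does not belong to DCFL(d−1). -/

import Mathlib

/-!
Formalization of one-way deterministic pushdown automata (1dpda) following
Yamakami, "Intersection and Union Hierarchies of Deterministic Context-Free
Languages and Pumping Lemmas".
-/

namespace DCFLFormal

/-- Tape symbols: the left endmarker ¢, the right endmarker $, and input symbols. -/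
inductive TSym (α : Type) : Type
  | lend : TSym α
  | rend : TSym α
  | ch : α → TSym α

/-- A one-way deterministic pushdown automaton (1dpda).  `δ q (some t) a` is the
transition reading the tape symbol `t` with top stack symbol `a`; `δ q none a`
is the ε-transition.  The value `some (p, w)` means: change state to `p` and
replace the topmost stack symbol by the string `w`. -/
structure DPDA (Q α Γ : Type) where
  δ : Q → Option (TSym α) → Γ → Option (Q × List Γ)
  q0 : Q
  Z0 : Γ
  Acc : Set Q
  Rej : Set Q

/-- A configuration: current state, remaining (unread) tape, and stack content
(topmost symbol first, the bottom marker last). -/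
structure Cfg (Q α Γ : Type) where
  st : Q
  inp : List (TSym α)
  stk : List Γ

namespace DPDA

variable {Q α Γ : Type}

/-- Halting (accepting or rejecting) states. -/
def IsHalting (M : DPDA Q α Γ) (q : Q) : Prop := q ∈ M.Acc ∨ q ∈ M.Rej

/-- One step of the machine: an ε-move if one is defined, otherwise read the
next tape symbol; the head moves right exactly when a tape symbol is read. -/
def step (M : DPDA Q α Γ) (c : Cfg Q α Γ) : Option (Cfg Q α Γ) :=
  match c.stk with
  | [] => none
  | a :: s =>
    match M.δ c.st none a with
    | some (p, w) => some ⟨p, c.inp, w ++ s⟩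
    | none =>
      match c.inp with
      | [] => none
      | t :: rest =>
        match M.δ c.st (some t) a with
        | some (p, w) => some ⟨p, rest, w ++ s⟩
        | none => none

/-- Iterated steps. -/
def stepN (M : DPDA Q α Γ) : ℕ → Cfg Q α Γ → Option (Cfg Q α Γ)
  | 0, c => some c
  | n + 1, c => (M.step c).bind (M.stepN n)

/-- The tape holding ¢ x $. -/
def tape (x : List α) : List (TSym α) :=
  TSym.lend :: x.map TSym.ch ++ [TSym.rend]

/-- The initial configuration on input `x`. -/
def init (M : DPDA Q α Γ) (x : List α) : Cfg Q α Γ := ⟨M.q0, tape x, [M.Z0]⟩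

/-- `M` accepts `x`: the computation reaches an accepting state. -/
def Accepts (M : DPDA Q α Γ) (x : List α) : Prop :=
  ∃ n c, M.stepN n (M.init x) = some c ∧ c.st ∈ M.Acc

/-- `M` rejects `x`: the computation reaches a rejecting state. -/
def Rejects (M : DPDA Q α Γ) (x : List α) : Prop :=
  ∃ n c, M.stepN n (M.init x) = some c ∧ c.st ∈ M.Rej

/-- `M` halts (in an accepting or rejecting state) on every input. -/
def HaltsOnAll (M : DPDA Q α Γ) : Prop :=
  ∀ x : List α, ∃ n c, M.stepN n (M.init x) = some c ∧ M.IsHalting c.st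

/-- The language recognized by `M`. -/
def lang (M : DPDA Q α Γ) : Set (List α) := {x | M.Accepts x}

/-- Well-formedness of a 1dpda: accepting and rejecting states are disjoint,
halting states have no outgoing transitions, for every non-halting state,
stack symbol and (non-empty) tape symbol exactly one of the symbol- and the
ε-transition is defined, and the bottom marker Z₀ is never removed. -/
def Valid (M : DPDA Q α Γ) : Prop :=
  (∀ q, q ∈ M.Acc → q ∉ M.Rej) ∧
  (∀ q, M.IsHalting q → ∀ σ a, M.δ q σ a = none) ∧
  (∀ q, ¬ M.IsHalting q → ∀ σ a, ((M.δ q (some σ) a).isSome ↔ M.δ q none a = none)) ∧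
  (∀ q σ p w, M.δ q σ M.Z0 = some (p, w) → w ≠ [])

end DPDA

/-- A language is deterministic context-free if it is recognized by some 1dpda
(with finitely many states and stack symbols) that halts on all inputs. -/
def IsDCFL {α : Type} (L : Set (List α)) : Prop :=
  ∃ (Q Γ : Type) (_ : Fintype Q) (_ : Fintype Γ) (M : DPDA Q α Γ),
    M.Valid ∧ M.HaltsOnAll ∧ L = M.lang

/-- `DCFL(d)`: intersections of `d` dcf languages. -/
def DCFLInter {α : Type} (d : ℕ) (L : Set (List α)) : Prop :=
  ∃ f : Fin d → Set (List α), (∀ i, IsDCFL (f i)) ∧ L = ⋂ i, f i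

/-- `DCFL[d]`: unions of `d` dcf languages. -/
def DCFLUnion {α : Type} (d : ℕ) (L : Set (List α)) : Prop :=
  ∃ f : Fin d → Set (List α), (∀ i, IsDCFL (f i)) ∧ L = ⋃ i, f i

/-- `rep x i` is the string `x` repeated `i` times. -/
def rep {α : Type} (x : List α) (i : ℕ) : List α := (List.replicate i x).flatten

/-- `(x, y)` is an iterative pair of the string `u ++ x ++ v ++ y ++ z` for `L`. -/
def IterPair {α : Type} (L : Set (List α)) (u x v y z : List α) : Prop :=
  1 ≤ (x ++ y).length ∧ ∀ i : ℕ, u ++ rep x i ++ v ++ rep y i ++ z ∈ L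

/-- A nondegenerate iterative pair: either `{u xⁱ v yʲ z ∈ L : j ≥ 0}` is finite
for each `i`, or `{u xⁱ v yʲ z ∈ L : i ≥ 0}` is finite for each `j`. -/
def NonDegIterPair {α : Type} (L : Set (List α)) (u x v y z : List α) : Prop :=
  IterPair L u x v y z ∧
  ((∀ i : ℕ, {s | s ∈ L ∧ ∃ j : ℕ, s = u ++ rep x i ++ v ++ rep y j ++ z}.Finite) ∨
   (∀ j : ℕ, {s | s ∈ L ∧ ∃ i : ℕ, s = u ++ rep x i ++ v ++ rep y j ++ z}.Finite))


/-- The language `L_d^(≤) = {a₁^{n₁} ⋯ a_d^{n_d} b₁^{m₁} ⋯ b_d^{m_d} : nᵢ ≤ mᵢ}`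
over the alphabet `Fin d ⊕ Fin d` (where `Sum.inl i = aᵢ` and `Sum.inr i = bᵢ`). -/
def Lle (d : ℕ) : Set (List (Fin d ⊕ Fin d)) :=
  {s | ∃ n m : Fin d → ℕ, (∀ i, n i ≤ m i) ∧
    s = (List.ofFn fun i => List.replicate (n i) (Sum.inl i : Fin d ⊕ Fin d)).flatten ++
        (List.ofFn fun i => List.replicate (m i) (Sum.inr i : Fin d ⊕ Fin d)).flatten}

namespace DPDA

variable {Q α Γ : Type} {M : DPDA Q α Γ}

theorem stepN_add (m n : ℕ) (c : Cfg Q α Γ) :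
    M.stepN (m + n) c = (M.stepN m c).bind (M.stepN n) := by
  induction m generalizing c with
  | zero => simp [stepN]
  | succ m ih =>
    rw [Nat.add_right_comm]
    simp only [stepN]
    cases M.step c with
    | none => rfl
    | some e => simpa using ih e

/-- A move depends only on the topmost stack symbol and on at most one input symbol. -/
theorem step_local {p : Q} {inp : List (TSym α)} {ξ : List Γ} {c : Cfg Q α Γ}
    (h : M.step ⟨p, inp, ξ⟩ = some c) :
    ∃ a s κ rest p' w, ξ = a :: s ∧ inp = κ ++ rest ∧ κ.length ≤ 1 ∧ c = ⟨p', rest, w ++ s⟩ ∧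
      ∀ rest' s', M.step ⟨p, κ ++ rest', a :: s'⟩ = some ⟨p', rest', w ++ s'⟩ := by
  cases ξ with
  | nil => simp [step] at h
  | cons a s =>
    cases hε : M.δ p none a with
    | some pw =>
      simp only [step, hε, Option.some.injEq] at h
      exact ⟨a, s, [], inp, pw.1, pw.2, rfl, rfl, by simp, h.symm, fun _ _ => by simp [step, hε]⟩
    | none =>
      cases inp with
      | nil => simp [step, hε] at h
      | cons t rest =>
        cases hσ : M.δ p (some t) a with
        | none => simp [step, hε, hσ] at h
        | some pw =>
          simp only [step, hε, hσ, Option.some.injEq] at h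
          exact ⟨a, s, [t], rest, pw.1, pw.2, rfl, rfl, by simp, h.symm,
            fun _ _ => by simp [step, hε, hσ]⟩

theorem stepN_append {n : ℕ} {p q : Q} {u v : List (TSym α)} {ξ ζ : List Γ}
    (h : M.stepN n ⟨p, u, ξ⟩ = some ⟨q, v, ζ⟩) (w : List (TSym α)) (S : List Γ) :
    M.stepN n ⟨p, u ++ w, ξ ++ S⟩ = some ⟨q, v ++ w, ζ ++ S⟩ := by
  induction n generalizing p u ξ with
  | zero =>
    simp only [stepN, Option.some.injEq, Cfg.mk.injEq] at h ⊢
    grind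
  | succ n ih =>
    simp only [stepN, Option.bind_eq_some_iff] at h ⊢
    obtain ⟨c, hc, hn⟩ := h
    obtain ⟨a, s, κ, rest, p', w', rfl, rfl, -, rfl, hl⟩ := step_local hc
    refine ⟨_, ?_, ih hn⟩
    simpa using hl (rest ++ w) (s ++ S)

/-- The configuration `c` leads to acceptance. -/
def AccFrom (M : DPDA Q α Γ) (c : Cfg Q α Γ) : Prop :=
  ∃ n c', M.stepN n c = some c' ∧ c'.st ∈ M.Acc

/-- Reading exactly the word `u` can turn state `p` and stack `ξ` into state `q` and stack `ζ`. -/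
def Reads (M : DPDA Q α Γ) (p : Q) (ξ : List Γ) (u : List (TSym α)) (q : Q) (ζ : List Γ) : Prop :=
  ∃ n, M.stepN n ⟨p, u, ξ⟩ = some ⟨q, [], ζ⟩

theorem accFrom_of_mem {p : Q} (h : p ∈ M.Acc) (w : List (TSym α)) (ξ : List Γ) :
    M.AccFrom ⟨p, w, ξ⟩ := ⟨0, _, rfl, h⟩

theorem AccFrom.of_step {c c' : Cfg Q α Γ} (h : M.step c = some c') (h' : M.AccFrom c') :
    M.AccFrom c := by
  obtain ⟨n, e, hn, he⟩ := h'
  exact ⟨n + 1, e, by simp [stepN, h, hn], he⟩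

theorem Valid.step_eq_none (hM : M.Valid) {c : Cfg Q α Γ} (h : c.st ∈ M.Acc) :
    M.step c = none := by
  have := hM.2.1 c.st (Or.inl h)
  rcases c with ⟨p, _ | ⟨t, rest⟩, _ | ⟨a, s⟩⟩ <;> simp_all [step]

theorem Valid.accFrom_step_iff (hM : M.Valid) {c c' : Cfg Q α Γ} (h : M.step c = some c') :
    M.AccFrom c ↔ M.AccFrom c' := by
  refine ⟨?_, AccFrom.of_step h⟩
  rintro ⟨_ | n, e, hn, he⟩
  · simp only [stepN, Option.some.injEq] at hn
    subst hn
    simp [hM.step_eq_none he] at h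
  · simp only [stepN, h, Option.bind_some] at hn
    exact ⟨n, e, hn, he⟩

theorem Valid.accFrom_stepN_iff (hM : M.Valid) {n : ℕ} {c c' : Cfg Q α Γ}
    (h : M.stepN n c = some c') : M.AccFrom c ↔ M.AccFrom c' := by
  induction n generalizing c with
  | zero => simp_all [stepN]
  | succ n ih =>
    simp only [stepN, Option.bind_eq_some_iff] at h
    obtain ⟨e, he, hn⟩ := h
    rw [hM.accFrom_step_iff he, ih hn]

theorem accFrom_nil_iff {p : Q} {w : List (TSym α)} : M.AccFrom ⟨p, w, []⟩ ↔ p ∈ M.Acc := by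
  refine ⟨?_, fun h => accFrom_of_mem h _ _⟩
  rintro ⟨_ | n, e, hn, he⟩
  · simp only [stepN, Option.some.injEq] at hn
    subst hn
    exact he
  · simp [stepN, step] at hn

namespace Reads

variable {p q r : Q} {ξ ζ θ : List Γ} {u v : List (TSym α)}

theorem refl (p : Q) (ξ : List Γ) : M.Reads p ξ [] p ξ := ⟨0, rfl⟩

theorem frame (h : M.Reads p ξ u q ζ) (S : List Γ) : M.Reads p (ξ ++ S) u q (ζ ++ S) := by
  obtain ⟨n, hn⟩ := h
  exact ⟨n, by simpa using stepN_append hn [] S⟩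

theorem trans (h : M.Reads p ξ u q ζ) (h' : M.Reads q ζ v r θ) : M.Reads p ξ (u ++ v) r θ := by
  obtain ⟨n, hn⟩ := h
  obtain ⟨m, hm⟩ := h'
  refine ⟨n + m, ?_⟩
  have := stepN_append hn v []
  simp only [List.append_nil, List.nil_append] at this
  simp [stepN_add, this, hm]

theorem of_step {κ : List (TSym α)} (h : M.step ⟨p, κ ++ u, ξ⟩ = some ⟨r, u, θ⟩)
    (h' : M.Reads r θ u q ζ) : M.Reads p ξ (κ ++ u) q ζ := by
  obtain ⟨n, hn⟩ := h'
  exact ⟨n + 1, by simp [stepN, h, hn]⟩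

theorem accFrom_iff (h : M.Reads p ξ u q ζ) (hM : M.Valid) (w : List (TSym α)) :
    M.AccFrom ⟨p, u ++ w, ξ⟩ ↔ M.AccFrom ⟨q, w, ζ⟩ := by
  obtain ⟨n, hn⟩ := h
  have := stepN_append hn w []
  simp only [List.append_nil, List.nil_append] at this
  exact hM.accFrom_stepN_iff this

/-- While the stack part `S` below `ξ` is not exposed, the run does not depend on it. -/
theorem restrict {S : List Γ} (h : M.Reads p (ξ ++ S) u q ζ) :
    (∃ u₁ u₂ r, u = u₁ ++ u₂ ∧ M.Reads p ξ u₁ r []) ∨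
      ∃ ζ', ζ = ζ' ++ S ∧ M.Reads p ξ u q ζ' := by
  obtain ⟨n, hn⟩ := h
  induction n generalizing p u ξ with
  | zero =>
    simp only [stepN, Option.some.injEq, Cfg.mk.injEq] at hn
    obtain ⟨rfl, rfl, rfl⟩ := hn
    exact Or.inr ⟨ξ, rfl, refl _ _⟩
  | succ n ih =>
    rcases ξ with _ | ⟨b, ξ⟩
    · exact Or.inl ⟨[], u, p, rfl, refl _ _⟩
    simp only [stepN, Option.bind_eq_some_iff] at hn
    obtain ⟨c, hc, hn⟩ := hn
    obtain ⟨a, s, κ, rest, p', w', h1, rfl, -, rfl, hl⟩ := step_local hc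
    simp only [List.cons_append, List.cons.injEq] at h1
    obtain ⟨rfl, rfl⟩ := h1
    rw [← List.append_assoc] at hn
    rcases ih hn with ⟨u₁, u₂, r, rfl, hr⟩ | ⟨ζ', rfl, hr⟩
    · exact Or.inl ⟨κ ++ u₁, u₂, r, by simp, of_step (hl _ _) hr⟩
    · exact Or.inr ⟨ζ', rfl, of_step (hl _ _) hr⟩

end Reads

/-- A prefix with both accepted and rejected extensions is read completely. -/
theorem exists_reads {p : Q} {ξ : List Γ} {u w w' : List (TSym α)}
    (h : M.AccFrom ⟨p, u ++ w, ξ⟩) (h' : ¬ M.AccFrom ⟨p, u ++ w', ξ⟩) :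
    ∃ q ζ, M.Reads p ξ u q ζ := by
  obtain ⟨n, c, hn, hc⟩ := h
  induction n generalizing p u ξ with
  | zero =>
    simp only [stepN, Option.some.injEq] at hn
    subst hn
    exact absurd (accFrom_of_mem hc _ _) h'
  | succ n ih =>
    rcases u with _ | ⟨t, u⟩
    · exact ⟨p, ξ, Reads.refl _ _⟩
    simp only [stepN, Option.bind_eq_some_iff] at hn
    obtain ⟨e, he, hn⟩ := hn
    obtain ⟨a, s, κ, rest, p', v, rfl, h1, hκ, rfl, hl⟩ := step_local he
    rcases κ with _ | ⟨t', _ | ⟨_, κ⟩⟩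
    · simp only [List.nil_append] at h1 hl
      subst h1
      obtain ⟨q, ζ, hr⟩ := ih (fun hA => h' (AccFrom.of_step (hl _ _) hA)) hn
      exact ⟨q, ζ, Reads.of_step (κ := []) (hl _ _) hr⟩
    · simp only [List.cons_append, List.nil_append, List.cons.injEq] at h1
      obtain ⟨rfl, rfl⟩ := h1
      obtain ⟨q, ζ, hr⟩ := ih (fun hA => h' (AccFrom.of_step (hl _ _) hA)) hn
      exact ⟨q, ζ, Reads.of_step (κ := [t]) (hl _ _) hr⟩
    · simp at hκ

theorem AccFrom.congr_stack {p : Q} {ξ S : List Γ} {w : List (TSym α)}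
    (h : M.AccFrom ⟨p, w, ξ ++ S⟩) (hw : ∀ u v q, w = u ++ v → ¬ M.Reads p ξ u q [])
    (T : List Γ) : M.AccFrom ⟨p, w, ξ ++ T⟩ := by
  obtain ⟨n, c, hn, hc⟩ := h
  induction n generalizing p w ξ with
  | zero =>
    simp only [stepN, Option.some.injEq] at hn
    subst hn
    exact accFrom_of_mem hc _ _
  | succ n ih =>
    rcases ξ with _ | ⟨b, ξ⟩
    · exact absurd (Reads.refl _ _) (hw [] w p rfl)
    simp only [stepN, Option.bind_eq_some_iff] at hn
    obtain ⟨e, he, hn⟩ := hn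
    obtain ⟨a, s, κ, rest, p', v, h1, rfl, -, rfl, hl⟩ := step_local he
    simp only [List.cons_append, List.cons.injEq] at h1
    obtain ⟨rfl, rfl⟩ := h1
    rw [← List.append_assoc] at hn
    have := ih (fun u v' q hu hr => hw (κ ++ u) v' q (by simp [hu]) (Reads.of_step (hl _ _) hr)) hn
    exact this.of_step (by simpa using hl rest (ξ ++ T))

/-- `a` keeps the topmost symbol of the stack `ξ` in state `p` from being removed, however often
it is read. -/
def TopSolid (M : DPDA Q α Γ) (a : TSym α) (p : Q) (ξ : List Γ) : Prop :=
  ∃ A S, ξ = A :: S ∧ ∀ r q, ¬ M.Reads p [A] (List.replicate r a) q []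

theorem TopSolid.not_reads_nil {a : TSym α} {p : Q} {ξ : List Γ} (h : M.TopSolid a p ξ)
    (r : ℕ) (q : Q) : ¬ M.Reads p ξ (List.replicate r a) q [] := by
  obtain ⟨A, S, rfl, hA⟩ := h
  intro hr
  rcases Reads.restrict (ξ := [A]) (S := S) hr with ⟨u₁, u₂, q', hu, hr'⟩ | ⟨ζ, hζ, hr'⟩
  · obtain ⟨-, hu₁, -⟩ := List.replicate_eq_append_iff.1 hu
    exact hA _ _ (hu₁ ▸ hr')
  · obtain rfl : ζ = [] := (List.append_eq_nil_iff.1 hζ.symm).1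
    exact hA _ _ hr'

theorem TopSolid.take {a : TSym α} {p : Q} {ξ : List Γ} (h : M.TopSolid a p ξ) {n : ℕ}
    (hn : 0 < n) : M.TopSolid a p (ξ.take n) := by
  obtain ⟨A, S, rfl, hA⟩ := h
  obtain ⟨n, rfl⟩ := Nat.exists_eq_succ_of_ne_zero hn.ne'
  exact ⟨A, S.take n, rfl, hA⟩

theorem exists_topSolid {a : TSym α} {p : Q} {ξ : List Γ}
    (h : ∀ r q, ¬ M.Reads p ξ (List.replicate r a) q []) :
    ∃ r q ζ, M.Reads p ξ (List.replicate r a) q ζ ∧ M.TopSolid a q ζ := by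
  induction ξ generalizing p with
  | nil => exact absurd (Reads.refl _ _) (h 0 p)
  | cons A S ih =>
    by_cases hA : ∀ r q, ¬ M.Reads p [A] (List.replicate r a) q []
    · exact ⟨0, p, A :: S, Reads.refl _ _, A, S, rfl, hA⟩
    push Not at hA
    obtain ⟨r, q, hr⟩ := hA
    have hr : M.Reads p (A :: S) (List.replicate r a) q S := by simpa using hr.frame S
    obtain ⟨r', q', ζ, hr', hs⟩ := ih (p := q) fun r' q' h' => h (r + r') q' <| by
      rw [List.replicate_add]; exact hr.trans h'
    exact ⟨r + r', q', ζ, by rw [List.replicate_add]; exact hr.trans hr', hs⟩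

/-- Some continuations of the input after any number of `a`s are accepted, others are not. -/
def Undecided (M : DPDA Q α Γ) (a : TSym α) (c : Cfg Q α Γ) : Prop :=
  ∀ r, (∃ w, M.AccFrom ⟨c.st, c.inp ++ (List.replicate r a ++ w), c.stk⟩) ∧
    ∃ w, ¬ M.AccFrom ⟨c.st, c.inp ++ (List.replicate r a ++ w), c.stk⟩

theorem Undecided.of_reads {a : TSym α} {p q : Q} {ξ ζ : List Γ} {u : List (TSym α)} {r : ℕ}
    (h : M.Undecided a ⟨p, u, ξ⟩) (hM : M.Valid)
    (hr : M.Reads p ξ (u ++ List.replicate r a) q ζ) : M.Undecided a ⟨q, [], ζ⟩ := by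
  intro n
  have key : ∀ w, M.AccFrom ⟨q, [] ++ (List.replicate n a ++ w), ζ⟩ ↔
      M.AccFrom ⟨p, u ++ (List.replicate (r + n) a ++ w), ξ⟩ := fun w => by
    rw [List.nil_append, ← hr.accFrom_iff hM, List.replicate_add, List.append_assoc,
      List.append_assoc]
  exact ⟨(h (r + n)).1.imp fun w => (key w).2, (h (r + n)).2.imp fun w => mt (key w).1⟩

theorem Undecided.not_reads_nil {a : TSym α} {p : Q} {ξ : List Γ}
    (h : M.Undecided a ⟨p, [], ξ⟩) (hM : M.Valid) (r : ℕ) (q : Q) :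
    ¬ M.Reads p ξ (List.replicate r a) q [] := by
  intro hr
  obtain ⟨⟨w, hw⟩, w', hw'⟩ := (h.of_reads (u := []) hM hr) 0
  exact hw' (accFrom_nil_iff.2 (accFrom_nil_iff.1 hw))

/-- `z = (s, p, ξ)` describes a configuration, reached after reading `X` and `c + s` copies of `a`
with `s ≤ G`, whose topmost stack symbol survives the reading of further copies of `a`. -/
def IsCut (M : DPDA Q α Γ) (a : TSym α) (G : ℕ) (X : List (TSym α)) (c : ℕ)
    (z : ℕ × Q × List Γ) : Prop :=
  z.1 ≤ G ∧ M.Reads M.q0 [M.Z0] (X ++ List.replicate (c + z.1) a) z.2.1 z.2.2 ∧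
    M.TopSolid a z.2.1 z.2.2

theorem exists_isCut [Finite Q] [Finite Γ] (hM : M.Valid) (a : TSym α) :
    ∃ G, ∀ X, M.Undecided a ⟨M.q0, X, [M.Z0]⟩ → ∃ c₀, ∀ c, c₀ ≤ c → ∃ z, M.IsCut a G X c z := by
  have hγ : ∀ x : Q × Γ, ∃ γ : ℕ, ∀ S, M.Undecided a ⟨x.1, [], x.2 :: S⟩ →
      M.TopSolid a x.1 (x.2 :: S) →
      ∃ γ', γ' ≤ γ ∧ ∃ q ζ, M.Reads x.1 [x.2] (List.replicate (γ' + 1) a) q ζ ∧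
        M.TopSolid a q ζ := by
    rintro ⟨p, A⟩
    by_cases hex : ∃ S, M.Undecided a ⟨p, [], A :: S⟩ ∧ M.TopSolid a p (A :: S)
    · obtain ⟨S, hu, hs⟩ := hex
      obtain ⟨⟨w, hw⟩, w', hw'⟩ := hu 1
      obtain ⟨q, ζ, hr⟩ : ∃ q ζ, M.Reads p (A :: S) (List.replicate 1 a) q ζ :=
        exists_reads (by simpa using hw) (by simpa using hw')
      have hs' : ∀ r q, ¬ M.Reads p [A] (List.replicate r a) q [] :=
        TopSolid.not_reads_nil (hs.take (n := 1) one_pos)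
      rcases Reads.restrict (ξ := [A]) (S := S) hr with ⟨u₁, u₂, q', hu', hr'⟩ | ⟨ζ, rfl, hr'⟩
      · obtain ⟨-, hu₁, -⟩ := List.replicate_eq_append_iff.1 hu'
        exact absurd (hu₁ ▸ hr') (hs' _ _)
      obtain ⟨γ, q', ζ', hr2, hs2⟩ := exists_topSolid (M := M) (a := a) (p := q) (ξ := ζ)
        fun r q' h' => hs' (1 + r) q' <| by rw [List.replicate_add]; exact hr'.trans h'
      refine ⟨γ, fun _ _ _ => ⟨γ, le_rfl, q', ζ', ?_, hs2⟩⟩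
      rw [Nat.add_comm, List.replicate_add]
      exact hr'.trans hr2
    · push Not at hex
      exact ⟨0, fun S h1 h2 => absurd h2 (hex S h1)⟩
  choose γ hγ using hγ
  obtain ⟨G, hG⟩ := (Set.finite_range γ).bddAbove
  refine ⟨G, fun X hX => ?_⟩
  obtain ⟨⟨w, hw⟩, w', hw'⟩ := hX 0
  obtain ⟨p₀, ξ₀, h₀⟩ := exists_reads hw hw'
  have hU₀ : M.Undecided a ⟨p₀, [], ξ₀⟩ := hX.of_reads (r := 0) hM (by simpa using h₀)
  obtain ⟨c₀, p₁, ξ₁, h₁, hs₁⟩ := exists_topSolid (hU₀.not_reads_nil hM)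
  refine ⟨c₀, fun c hc => ?_⟩
  induction c, hc using Nat.le_induction with
  | base => exact ⟨(0, p₁, ξ₁), Nat.zero_le _, h₀.trans h₁, hs₁⟩
  | succ c _ ih =>
    obtain ⟨⟨s, p, ξ⟩, hsG, hr, hs⟩ := ih
    rcases s with _ | s
    · obtain ⟨A, S, rfl, hA⟩ := hs
      obtain ⟨γ', hγ', q, ζ, hr', hs'⟩ :=
        hγ (p, A) S (hX.of_reads hM hr) ⟨A, S, rfl, hA⟩
      refine ⟨(γ', q, ζ ++ S), hγ'.trans (hG ⟨_, rfl⟩), ?_, ?_⟩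
      · have := hr.trans (hr'.frame S)
        rw [List.append_assoc, ← List.replicate_add] at this
        convert this using 3
        simp; ring
      · obtain ⟨B, S', rfl, hB⟩ := hs'
        exact ⟨B, S' ++ S, rfl, hB⟩
    · refine ⟨(s, p, ξ), (Nat.le_succ s).trans hsG, ?_, hs⟩
      convert hr using 3
      simp; ring

end DPDA

open Classical in
/-- Infinite Ramsey theorem: a colouring of strictly increasing sequences with finitely many colours
that depends only on the first `r` terms is constant on the subsequences of some sequence. -/
theorem exists_homogeneous_subseq (r : ℕ) {K : Type*} [Finite K] (f : (ℕ → ℕ) → K)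
    (hf : ∀ v w : ℕ → ℕ, (∀ t < r, v t = w t) → f v = f w) :
    ∃ θ : ℕ → ℕ, StrictMono θ ∧ ∃ κ, ∀ σ : ℕ → ℕ, StrictMono σ → f (θ ∘ σ) = κ := by
  induction r generalizing f with
  | zero => exact ⟨id, strictMono_id, f id, fun σ _ => hf _ _ (by simp)⟩
  | succ r ih =>
    let cons : ℕ → (ℕ → ℕ) → ℕ → ℕ := fun x w t => Nat.casesOn t x w
    have hcons : ∀ w : ℕ → ℕ, cons (w 0) (w ∘ Nat.succ) = w := fun w => by
      funext t; cases t <;> rfl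
    have step : ∀ φ : ℕ → ℕ, ∃ θ : ℕ → ℕ, StrictMono θ ∧ ∃ κ, ∀ σ : ℕ → ℕ, StrictMono σ →
        f (cons (φ 0) (φ ∘ Nat.succ ∘ θ ∘ σ)) = κ := fun φ => by
      refine ih (fun w => f (cons (φ 0) (φ ∘ Nat.succ ∘ w))) fun v w h => hf _ _ fun t ht => ?_
      cases t with
      | zero => rfl
      | succ t => simp [cons, h t (by omega)]
    choose Θ hΘ κ hκ using step
    let Φ : ℕ → ℕ → ℕ := fun n => Nat.rec id (fun _ φ => φ ∘ Nat.succ ∘ Θ φ) n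
    have hΦs : ∀ n, Φ (n + 1) = Φ n ∘ Nat.succ ∘ Θ (Φ n) := fun n => rfl
    have hΦ : ∀ n, StrictMono (Φ n) := fun n => by
      induction n with
      | zero => exact strictMono_id
      | succ n ihn =>
        rw [hΦs]
        exact ihn.comp (Order.succ_strictMono.comp (hΘ _))
    have hrange : ∀ n m, n ≤ m → Set.range (Φ m) ⊆ Set.range (Φ n) := fun n m h => by
      induction m, h using Nat.le_induction with
      | base => exact subset_rfl
      | succ m _ ihm => exact (Set.range_comp_subset_range _ _).trans ihm
    let x : ℕ → ℕ := fun n => Φ n 0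
    have hx : StrictMono x := strictMono_nat_of_lt_succ fun n => by
      change Φ n 0 < Φ n (Nat.succ (Θ (Φ n) 0))
      exact hΦ n (Nat.succ_pos _)
    obtain ⟨κ₀, hκ₀⟩ := Finite.exists_infinite_fiber fun n => κ (Φ n)
    obtain ⟨ρ, hρ, hρκ⟩ := Filter.extraction_of_frequently_atTop
      (Nat.frequently_atTop_iff_infinite.2 (Set.infinite_coe_iff.1 hκ₀))
    refine ⟨x ∘ ρ, hx.comp hρ, κ₀, fun σ hσ => ?_⟩
    set n := ρ (σ 0) with hn
    have hmem : ∀ t, ∃ y, Φ (n + 1) y = x (ρ (σ (t + 1))) := fun t =>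
      hrange (n + 1) _ (hρ (hσ (Nat.succ_pos t))) ⟨0, rfl⟩
    choose τ hτ using hmem
    have hτm : StrictMono τ := fun s t hst => by
      rw [← (hΦ (n + 1)).lt_iff_lt, hτ, hτ]
      exact hx (hρ (hσ (by omega)))
    have h1 : (x ∘ ρ) ∘ σ = cons (Φ n 0) (Φ n ∘ Nat.succ ∘ Θ (Φ n) ∘ τ) := by
      rw [← hcons ((x ∘ ρ) ∘ σ)]
      congr 1
      funext t
      exact (hτ t).symm
    rw [h1, hκ _ _ hτm]
    exact hρκ (σ 0)

/-- The word `x_lo ^ N lo ⋯ x_{hi-1} ^ N (hi-1)`. -/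
def seg {β : Type*} (x : ℕ → β) (N : ℕ → ℕ) (lo hi : ℕ) : List β :=
  (List.range' lo (hi - lo)).flatMap fun ℓ => List.replicate (N ℓ) (x ℓ)

section seg

variable {β : Type*} {x : ℕ → β} {N N' : ℕ → ℕ} {lo mid hi : ℕ}

@[simp] theorem seg_self : seg x N lo lo = [] := by simp [seg]

theorem seg_append (h₁ : lo ≤ mid) (h₂ : mid ≤ hi) :
    seg x N lo mid ++ seg x N mid hi = seg x N lo hi := by
  obtain ⟨m, rfl⟩ := Nat.exists_eq_add_of_le h₁
  obtain ⟨n, rfl⟩ := Nat.exists_eq_add_of_le h₂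
  rw [seg, seg, seg, ← List.flatMap_append, Nat.add_sub_cancel_left, Nat.add_sub_cancel_left,
    List.range'_append_1, Nat.add_assoc, Nat.add_sub_cancel_left]

theorem seg_eq_append (h : lo < hi) :
    seg x N lo hi = List.replicate (N lo) (x lo) ++ seg x N (lo + 1) hi := by
  rw [← seg_append (Nat.le_succ lo) h]
  simp [seg]

theorem seg_congr (h : ∀ ℓ, lo ≤ ℓ → ℓ < hi → N ℓ = N' ℓ) : seg x N lo hi = seg x N' lo hi := by
  unfold seg
  refine List.flatMap_congr fun ℓ hℓ => ?_
  rw [List.mem_range'_1] at hℓ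
  rw [h ℓ (by omega) (by omega)]

/-- A nonempty prefix of a segment ends inside one of the blocks. -/
theorem exists_of_append_eq_seg {u v : List β} (h : u ++ v = seg x N lo hi) (hu : u ≠ []) :
    ∃ ℓ e, lo ≤ ℓ ∧ ℓ < hi ∧ 1 ≤ e ∧ e ≤ N ℓ ∧ u = seg x N lo ℓ ++ List.replicate e (x ℓ) := by
  obtain ⟨n, hn⟩ : ∃ n, n = hi - lo := ⟨_, rfl⟩
  induction n generalizing lo u with
  | zero => simp [seg, ← hn, hu] at h
  | succ n ih =>
    rw [seg_eq_append (by omega), List.append_eq_append_iff] at h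
    rcases h with ⟨as, h1, h2⟩ | ⟨cs, h1, h2⟩
    · obtain ⟨h3, h4, -⟩ := List.replicate_eq_append_iff.1 h1
      refine ⟨lo, u.length, le_rfl, by omega, List.length_pos_iff.2 hu, by omega, ?_⟩
      simpa using h4
    · rcases eq_or_ne cs [] with rfl | hcs
      · rw [List.append_nil] at h1
        refine ⟨lo, N lo, le_rfl, by omega, ?_, le_rfl, by simpa using h1⟩
        rcases Nat.eq_zero_or_pos (N lo) with h0 | h0
        · simp [h0] at h1; exact absurd h1 hu
        · exact h0
      · obtain ⟨ℓ, e, h3, h4, h5, h6, rfl⟩ := ih h2.symm hcs (by omega)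
        refine ⟨ℓ, e, by omega, h4, h5, h6, ?_⟩
        rw [h1, seg_eq_append (lo := lo) (by omega), List.append_assoc]

end seg

/-- The strictly increasing subsequences of `η`. -/
def Subseqs (η : ℕ → ℕ) : Set (ℕ → ℕ) := {v | ∃ σ : ℕ → ℕ, StrictMono σ ∧ v = η ∘ σ}

namespace Subseqs

variable {η v : ℕ → ℕ}

theorem comp_subset {θ : ℕ → ℕ} (hθ : StrictMono θ) : Subseqs (η ∘ θ) ⊆ Subseqs η := by
  rintro _ ⟨σ, hσ, rfl⟩
  exact ⟨θ ∘ σ, hθ.comp hσ, rfl⟩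

theorem strictMono (hη : StrictMono η) (hv : v ∈ Subseqs η) : StrictMono v := by
  obtain ⟨σ, hσ, rfl⟩ := hv
  exact hη.comp hσ

theorem three_mul_le (hη : StrictMono η) (h3 : ∀ t, 3 * η t ≤ η (t + 1)) (hv : v ∈ Subseqs η)
    (t : ℕ) : 3 * v t ≤ v (t + 1) := by
  obtain ⟨σ, hσ, rfl⟩ := hv
  exact (h3 _).trans (hη.monotone (hσ (Nat.lt_succ_self t)))

theorem le_apply (hη : StrictMono η) (hv : v ∈ Subseqs η) (t : ℕ) : η 0 ≤ v t := by
  obtain ⟨σ, hσ, rfl⟩ := hv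
  exact hη.monotone (Nat.zero_le _)

theorem exists_raise (hη : StrictMono η) (hv : v ∈ Subseqs η) (L B : ℕ) :
    ∃ w ∈ Subseqs η, (∀ t < L, w t = v t) ∧ ∀ t, L ≤ t → B ≤ w t := by
  obtain ⟨σ, hσ, rfl⟩ := hv
  refine ⟨_, ⟨fun t => if t < L then σ t else σ t + B, fun s t hst => ?_, rfl⟩, fun t ht => ?_,
    fun t ht => ?_⟩
  · have := hσ hst
    dsimp only
    split_ifs <;> omega
  · simp [ht]
  · simp only [Function.comp, not_lt.2 ht, if_false]
    exact (Nat.le_add_left _ _).trans hη.le_apply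

/-- A pair of subsequences that differ only at the places `s` and `s + 1`. -/
theorem exists_replace (η : ℕ → ℕ) (s : ℕ) :
    ∃ v ∈ Subseqs η, ∃ w ∈ Subseqs η, w s = v (s + 1) ∧ ∀ t, t ≠ s → t ≠ s + 1 → w t = v t := by
  refine ⟨_, ⟨fun t => 4 * t, strictMono_nat_of_lt_succ fun t => by omega, rfl⟩, _,
    ⟨fun t => 4 * t + if t = s then 4 else if t = s + 1 then 1 else 0,
      strictMono_nat_of_lt_succ fun t => ?_, rfl⟩, ?_, fun t h1 h2 => ?_⟩
  · split_ifs <;> omega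
  · simp [Nat.mul_add]
  · simp [h1, h2]

/-- A family of subsequences differing only at the place `s`, any two values of which can be
combined in another subsequence. -/
theorem exists_combine (η : ℕ → ℕ) (s K : ℕ) :
    ∃ u : ℕ → ℕ → ℕ, (∀ x ≤ K, u x ∈ Subseqs η) ∧ (∀ x, ∀ t < s, u x t = η t) ∧
      (∀ x y t, t ≠ s → u x t = u y t) ∧
      ∀ x y, x < y → y ≤ K → ∃ w ∈ Subseqs η, w s = u x s ∧ w (s + 1) = u y s ∧
        ∀ t, t ≠ s → t ≠ s + 1 → w t = u x t := by
  refine ⟨fun x => η ∘ fun t => if t < s then t else if t = s then s + x else t + K + 1,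
    fun x hx => ⟨_, fun a b hab => ?_, rfl⟩, fun x t ht => ?_, fun x y t ht => ?_, fun x y hxy hy => ⟨_,
      ⟨fun t => if t < s then t else if t = s then s + x else if t = s + 1 then s + y
        else t + K + 1, fun a b hab => ?_, rfl⟩, ?_, ?_, fun t h1 h2 => ?_⟩⟩
  · split_ifs <;> omega
  · simp [ht]
  · simp [ht]
  · dsimp only
    split_ifs <;> omega
  · simp
  · simp
  · simp [h1, h2]

end Subseqs

/-- `N` gives the exponents of a word of `Lle d` followed by one endmarker. -/
def Admissible (d : ℕ) (N : ℕ → ℕ) : Prop := N (2 * d) = 1 ∧ ∀ j < d, N j ≤ N (d + j)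

/-- Exponents assembled from a sequence: each of the first `d` ones is the sum of a large and a
small term, the small terms decreasing; the next `d` ones are larger still. -/
def expo (d : ℕ) (v : ℕ → ℕ) (ℓ : ℕ) : ℕ :=
  if ℓ < d then v (3 * d + ℓ) + v (3 * (d - 1 - ℓ)) else if ℓ < 2 * d then v (3 * d + ℓ) else 1

/-- The exponents `expo d v` with the inequality at `i` made an equality. -/
def tight (d i : ℕ) (v : ℕ → ℕ) : ℕ → ℕ :=
  Function.update (expo d v) (d + i) (v (3 * d + i) + v (3 * (d - 1 - i)))

/-- The exponents `expo d v` with exactly the inequality at `i` violated. -/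
def facet (d i : ℕ) (v : ℕ → ℕ) : ℕ → ℕ :=
  Function.update (tight d i v) i (v (3 * d + i) + v (3 * (d - 1 - i) + 1))

section expo

variable {d i j ℓ : ℕ} {v w : ℕ → ℕ}

theorem expo_of_lt (h : ℓ < d) : expo d v ℓ = v (3 * d + ℓ) + v (3 * (d - 1 - ℓ)) := if_pos h

theorem expo_of_le (h : d ≤ ℓ) (h' : ℓ < 2 * d) : expo d v ℓ = v (3 * d + ℓ) := by
  rw [expo, if_neg (by omega), if_pos h']

theorem expo_two_mul : expo d v (2 * d) = 1 := by
  rw [expo, if_neg (by omega), if_neg (by omega)]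

theorem expo_apply_congr (h : ℓ < 2 * d → v (3 * d + ℓ) = w (3 * d + ℓ))
    (h' : ℓ < d → v (3 * (d - 1 - ℓ)) = w (3 * (d - 1 - ℓ))) : expo d v ℓ = expo d w ℓ := by
  unfold expo
  split_ifs with h1 h2
  · rw [h (by omega), h' h1]
  · rw [h h2]
  · rfl

theorem expo_congr (h : ∀ t < 5 * d, v t = w t) : expo d v = expo d w := by
  funext ℓ
  exact expo_apply_congr (fun _ => h _ (by omega)) fun _ => h _ (by omega)

theorem expo_bound (hm : StrictMono v) (h3 : ∀ t, 3 * v t ≤ v (t + 1)) (hj : j < d) :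
    expo d v j ≤ 2 * v (3 * d + j) ∧ 3 * v (3 * d + j) ≤ v (3 * d + (d + j)) ∧
      expo d v (d + j) = v (3 * d + (d + j)) := by
  refine ⟨?_, (h3 _).trans (hm.monotone (by omega)), expo_of_le (by omega) (by omega)⟩
  have := hm.monotone (show 3 * (d - 1 - j) ≤ 3 * d + j by omega)
  rw [expo_of_lt hj]
  omega

theorem admissible_expo (hm : StrictMono v) (h3 : ∀ t, 3 * v t ≤ v (t + 1)) :
    Admissible d (expo d v) := by
  refine ⟨expo_two_mul, fun j hj => ?_⟩
  have := expo_bound hm h3 hj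
  omega

theorem tight_congr (hi : i < d) (h : ∀ t < 5 * d, v t = w t) : tight d i v = tight d i w := by
  rw [tight, tight, expo_congr h, h _ (by omega), h _ (by omega)]

theorem tight_of_ne (h : ℓ ≠ d + i) : tight d i v ℓ = expo d v ℓ := Function.update_of_ne h _ _

theorem tight_self : tight d i v (d + i) = v (3 * d + i) + v (3 * (d - 1 - i)) :=
  Function.update_self _ _ _

theorem facet_self : facet d i v i = v (3 * d + i) + v (3 * (d - 1 - i) + 1) :=
  Function.update_self _ _ _

theorem facet_of_ne (h : ℓ ≠ i) : facet d i v ℓ = tight d i v ℓ := Function.update_of_ne h _ _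

theorem admissible_tight (hm : StrictMono v) (h3 : ∀ t, 3 * v t ≤ v (t + 1)) (hi : i < d) :
    Admissible d (tight d i v) := by
  obtain ⟨h, h'⟩ := admissible_expo (d := d) hm h3
  refine ⟨by rw [tight_of_ne (by omega), h], fun j hj => ?_⟩
  rw [tight_of_ne (show j ≠ d + i by omega)]
  rcases eq_or_ne j i with rfl | hji
  · rw [tight_self, expo_of_lt hj]
  · rw [tight_of_ne (by omega)]
    exact h' j hj

end expo

namespace DPDA

variable {Q α Γ : Type} {M : DPDA Q α Γ} {x : ℕ → TSym α} {d : ℕ}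

/-- `M` accepts the tape content with exponents `N`. -/
def AccWord (M : DPDA Q α Γ) (x : ℕ → TSym α) (d : ℕ) (N : ℕ → ℕ) : Prop :=
  M.AccFrom ⟨M.q0, TSym.lend :: seg x N 0 (2 * d + 1), [M.Z0]⟩

theorem seg_zero_eq {N : ℕ → ℕ} {k : ℕ} (hk : k ≤ 2 * d) :
    seg x N 0 (2 * d + 1) =
      seg x N 0 k ++ (List.replicate (N k) (x k) ++ seg x N (k + 1) (2 * d + 1)) := by
  rw [← seg_eq_append (by omega), seg_append (Nat.zero_le _) (by omega)]

theorem IsCut.accWord_iff (hM : M.Valid) {N : ℕ → ℕ} {k G c g : ℕ} {z : ℕ × Q × List Γ}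
    (hk : k ≤ 2 * d) (hz : M.IsCut (x k) G (TSym.lend :: seg x N 0 k) c z) (hN : N k = c + g)
    (hg : G ≤ g) : M.AccWord x d N ↔ M.AccFrom ⟨z.2.1,
      List.replicate (g - z.1) (x k) ++ seg x N (k + 1) (2 * d + 1), z.2.2⟩ := by
  have hs := hz.1
  rw [AccWord, ← hz.2.1.accFrom_iff hM, seg_zero_eq hk, hN,
    show c + g = (c + z.1) + (g - z.1) by omega, List.replicate_add]
  simp only [List.append_assoc, List.cons_append]

/-- Two words whose runs expose the same stack part in the same state, and which agree from there
on, are both accepted or both not accepted. -/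
theorem accWord_iff_accWord (hM : M.Valid) {N₁ N₂ : ℕ → ℕ} {k G c g₁ g₂ n ℓ e₁ e₂ r : ℕ}
    {z : ℕ × Q × List Γ} {q : Q} (hkℓ : k < ℓ) (hℓ : ℓ ≤ 2 * d)
    (hz : M.IsCut (x k) G (TSym.lend :: seg x N₁ 0 k) c z) (hpre : ∀ m < k, N₁ m = N₂ m)
    (hk₁ : N₁ k = c + g₁) (hk₂ : N₂ k = c + g₂) (hg₁ : G ≤ g₁) (hg₂ : G ≤ g₂)
    (hr₁ : M.Reads z.2.1 (z.2.2.take n) (List.replicate (g₁ - z.1) (x k) ++ seg x N₁ (k + 1) ℓ ++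
      List.replicate e₁ (x ℓ)) q [])
    (hr₂ : M.Reads z.2.1 (z.2.2.take n) (List.replicate (g₂ - z.1) (x k) ++ seg x N₂ (k + 1) ℓ ++
      List.replicate e₂ (x ℓ)) q [])
    (he₁ : N₁ ℓ = e₁ + r) (he₂ : N₂ ℓ = e₂ + r)
    (hsuf : ∀ m, ℓ < m → m ≤ 2 * d → N₁ m = N₂ m) : M.AccWord x d N₁ ↔ M.AccWord x d N₂ := by
  have key : ∀ (N : ℕ → ℕ) (g e : ℕ), M.IsCut (x k) G (TSym.lend :: seg x N 0 k) c z →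
      N k = c + g → G ≤ g → M.Reads z.2.1 (z.2.2.take n) (List.replicate (g - z.1) (x k) ++
        seg x N (k + 1) ℓ ++ List.replicate e (x ℓ)) q [] → N ℓ = e + r →
      (M.AccWord x d N ↔ M.AccFrom ⟨q, List.replicate r (x ℓ) ++ seg x N (ℓ + 1) (2 * d + 1),
        z.2.2.drop n⟩) := by
    intro N g e hz hk hg hr he
    have hr' := hr.frame (z.2.2.drop n)
    rw [List.take_append_drop, List.nil_append] at hr'
    rw [hz.accWord_iff hM (by omega) hk hg, ← hr'.accFrom_iff hM,
      ← seg_append (show k + 1 ≤ ℓ by omega) (show ℓ ≤ 2 * d + 1 by omega),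
      seg_eq_append (show ℓ < 2 * d + 1 by omega), he, List.replicate_add]
    simp only [List.append_assoc]
  rw [key N₁ g₁ e₁ hz hk₁ hg₁ hr₁ he₁, key N₂ g₂ e₂ _ hk₂ hg₂ hr₂ he₂,
    seg_congr fun m h1 h2 => hsuf m (by omega) (by omega)]
  rwa [← seg_congr fun m _ h2 => hpre m h2]

theorem undecided_of_accWord {N : ℕ → ℕ} {k : ℕ} (hk : k ≤ 2 * d)
    (h : ∀ r, (∃ N', (∀ m < k, N' m = N m) ∧ r ≤ N' k ∧ M.AccWord x d N') ∧
      ∃ N', (∀ m < k, N' m = N m) ∧ r ≤ N' k ∧ ¬ M.AccWord x d N') :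
    M.Undecided (x k) ⟨M.q0, TSym.lend :: seg x N 0 k, [M.Z0]⟩ := by
  have key : ∀ (N' : ℕ → ℕ) (r : ℕ), (∀ m < k, N' m = N m) → r ≤ N' k → ∃ w,
      TSym.lend :: seg x N' 0 (2 * d + 1) =
        (TSym.lend :: seg x N 0 k) ++ (List.replicate r (x k) ++ w) := by
    intro N' r hN' hr
    refine ⟨List.replicate (N' k - r) (x k) ++ seg x N' (k + 1) (2 * d + 1), ?_⟩
    rw [seg_zero_eq hk, seg_congr fun m _ h2 => hN' m h2, ← List.append_assoc (List.replicate r _),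
      ← List.replicate_add, Nat.add_sub_cancel' hr, List.cons_append]
  intro r
  obtain ⟨⟨N₁, h1, h2, h3⟩, N₂, h4, h5, h6⟩ := h r
  obtain ⟨w₁, hw₁⟩ := key N₁ r h1 h2
  obtain ⟨w₂, hw₂⟩ := key N₂ r h4 h5
  rw [AccWord, hw₁] at h3
  rw [AccWord, hw₂] at h6
  exact ⟨⟨w₁, h3⟩, w₂, h6⟩

open Classical in
/-- A choice of the configuration described by `IsCut`. -/
noncomputable def cut (M : DPDA Q α Γ) (a : TSym α) (G : ℕ) (X : List (TSym α)) (c : ℕ) :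
    ℕ × Q × List Γ :=
  if h : ∃ z, M.IsCut a G X c z then h.choose else (0, M.q0, [])

theorem isCut_cut {a : TSym α} {G : ℕ} {X : List (TSym α)} {c : ℕ}
    (h : ∃ z, M.IsCut a G X c z) : M.IsCut a G X c (M.cut a G X c) := by
  rw [cut, dif_pos h]
  exact h.choose_spec

end DPDA

namespace DPDA

variable {Q α Γ : Type} {M : DPDA Q α Γ} {x : ℕ → TSym α} {d i k G ℓ : ℕ} {v w η : ℕ → ℕ} {q : Q}

/-- The chosen configuration after the blocks with exponents `N` before the `k`th one and `c` or
slightly more letters of the `k`th block. -/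
noncomputable def segCut (M : DPDA Q α Γ) (x : ℕ → TSym α) (G k : ℕ) (N : ℕ → ℕ) (c : ℕ) :
    ℕ × Q × List Γ :=
  M.cut (x k) G (TSym.lend :: seg x N 0 k) c

theorem segCut_congr {N N' : ℕ → ℕ} {c : ℕ} (h : ∀ m < k, N m = N' m) :
    M.segCut x G k N c = M.segCut x G k N' c := by
  rw [segCut, segCut, seg_congr fun m _ h2 => h m h2]

/-- `segCut` really is a cut. -/
def SegIsCut (M : DPDA Q α Γ) (x : ℕ → TSym α) (G k : ℕ) (N : ℕ → ℕ) (c : ℕ) : Prop :=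
  M.IsCut (x k) G (TSym.lend :: seg x N 0 k) c (M.segCut x G k N c)

theorem SegIsCut.congr {N N' : ℕ → ℕ} {c : ℕ} (h : ∀ m < k, N m = N' m)
    (hz : M.SegIsCut x G k N c) : M.SegIsCut x G k N' c := by
  rwa [SegIsCut, ← segCut_congr h, ← seg_congr fun m _ h2 => h m h2]

/-- From the cut in the `k`th block of `tight d i v` on, the machine first exposes the stack below
its topmost `v (3 * (d - 1 - k) + 2)` symbols within the `ℓ`th block, in state `q`. -/
def Exposes (M : DPDA Q α Γ) (x : ℕ → TSym α) (d i k G : ℕ) (v : ℕ → ℕ) (ℓ : ℕ) (q : Q) : Prop :=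
  ∃ e, 1 ≤ e ∧ e ≤ tight d i v ℓ ∧
    M.Reads (M.segCut x G k (expo d v) (v (3 * d + k))).2.1
      ((M.segCut x G k (expo d v) (v (3 * d + k))).2.2.take (v (3 * (d - 1 - k) + 2)))
      (List.replicate (v (3 * (d - 1 - k)) - (M.segCut x G k (expo d v) (v (3 * d + k))).1) (x k) ++
        seg x (tight d i v) (k + 1) ℓ ++ List.replicate e (x ℓ)) q []

/-- The cuts in the `k`th block of `expo d v` and `facet d i v` look the same from above. -/
def SameCut (M : DPDA Q α Γ) (x : ℕ → TSym α) (d i k G : ℕ) (v : ℕ → ℕ) : Prop :=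
  (M.segCut x G k (facet d i v) (v (3 * d + k))).1 =
      (M.segCut x G k (expo d v) (v (3 * d + k))).1 ∧
    (M.segCut x G k (facet d i v) (v (3 * d + k))).2.1 =
      (M.segCut x G k (expo d v) (v (3 * d + k))).2.1 ∧
    (M.segCut x G k (facet d i v) (v (3 * d + k))).2.2.take (v (3 * (d - 1 - k) + 2)) =
      (M.segCut x G k (expo d v) (v (3 * d + k))).2.2.take (v (3 * (d - 1 - k) + 2))

section

variable (hM : M.Valid) (hik : i < k) (hkd : k < d) (hacc : ∀ N, Admissible d N → M.AccWord x d N)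
  (hη : StrictMono η) (h3 : ∀ t, 3 * η t ≤ η (t + 1)) (hG : G ≤ η 0)
include hM hik hkd hacc hη h3 hG

theorem false_of_exposes_le (hrej : ∀ v ∈ Subseqs η, ¬ M.AccWord x d (facet d k v))
    (hcut : ∀ v ∈ Subseqs η, M.SegIsCut x G k (expo d v) (v (3 * d + k))) (hkℓ : k < ℓ)
    (hℓ : ℓ ≤ d + i) (h : ∀ v ∈ Subseqs η, M.Exposes x d i k G v ℓ q) : False := by
  obtain ⟨v, hv, w, hw, hs, ht⟩ := Subseqs.exists_replace η (3 * (d - 1 - k))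
  obtain ⟨e, he1, -, hr⟩ := h v hv
  obtain ⟨e', he1', -, hr'⟩ := h w hw
  have hpre : ∀ m < k, expo d w m = expo d v m := fun m hm =>
    expo_apply_congr (fun _ => ht _ (by omega) (by omega)) fun _ => ht _ (by omega) (by omega)
  rw [hs, ht (3 * d + k) (by omega) (by omega), ht (3 * (d - 1 - k) + 2) (by omega) (by omega),
    segCut_congr hpre] at hr'
  obtain ⟨u, hu, hu1, hu2⟩ := Subseqs.exists_raise hη hv (3 * d + ℓ) (e + e' + expo d v (ℓ - d))
  have hum := Subseqs.strictMono hη hu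
  have hu3 := Subseqs.three_mul_le hη h3 hu
  have hadm := admissible_tight (d := d) (i := k) hum hu3 hkd
  have huℓ := hu2 _ le_rfl
  have hexpo : ∀ m < ℓ, expo d u m = expo d v m := fun m hm =>
    expo_apply_congr (fun _ => hu1 _ (by omega)) fun _ => hu1 _ (by omega)
  have hN : ∀ m, m ≠ k → m ≠ d + k → facet d k u m = expo d u m := fun m h1 h2 => by
    rw [facet_of_ne h1, tight_of_ne h2]
  have hge : u (3 * d + ℓ) ≤ expo d u ℓ := by
    rcases lt_or_ge ℓ d with h | h
    · rw [expo_of_lt h]; omega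
    · rw [expo_of_le h (by omega)]
  have hNℓ := hN ℓ (by omega) (by omega)
  have hpre' : ∀ m < k, expo d v m = facet d k u m := fun m hm => by
    rw [hN m (by omega) (by omega), hexpo m (by omega)]
  rw [segCut_congr hpre'] at hr hr'
  let N₂ : ℕ → ℕ := fun m => if m = k then v (3 * d + k) + v (3 * (d - 1 - k)) else
    if m = ℓ then e + (facet d k u ℓ - e') else facet d k u m
  refine hrej u hu ((accWord_iff_accWord (N₂ := N₂) (g₁ := v (3 * (d - 1 - k) + 1))
    (g₂ := v (3 * (d - 1 - k))) (e₁ := e') (e₂ := e) (ℓ := ℓ) (r := facet d k u ℓ - e')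
    (n := v (3 * (d - 1 - k) + 2)) hM hkℓ (by omega)
    ((hcut v hv).congr hpre') (fun m hm => ?_) ?_ ?_ ?_ ?_ (q := q) ?_ ?_ ?_ ?_
    fun m h1 h2 => ?_).2 (hacc N₂ ⟨?_, fun j hj => ?_⟩))
  · simp [N₂, hm.ne, (hm.trans hkℓ).ne]
  · rw [facet_self, hu1 _ (by omega), hu1 _ (by omega)]
  · simp [N₂]
  · exact hG.trans (Subseqs.le_apply hη hv _)
  · exact hG.trans (Subseqs.le_apply hη hv _)
  · rw [seg_congr (N' := tight d i w)]
    · exact hr'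
    · intro m h1 h2
      rw [hN m (by omega) (by omega), tight_of_ne (by omega), hexpo m h2]
      exact (expo_apply_congr (fun _ => ht _ (by omega) (by omega))
        fun _ => ht _ (by omega) (by omega)).symm
  · rw [seg_congr (N' := tight d i v)]
    · exact hr
    · intro m h1 h2
      rw [tight_of_ne (by omega), ← hexpo m h2, ← hN m (by omega) (by omega)]
      simp [N₂, h2.ne, (show m ≠ k by omega)]
  · omega
  · simp [N₂, hkℓ.ne']
  · simp [N₂, h1.ne', (show m ≠ k by omega)]
  · have := hadm.1
    simp only [N₂]
    rw [if_neg (by omega), if_neg (by omega), facet_of_ne (by omega)]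
    exact this
  · have hb := expo_bound hum hu3 hj
    simp only [N₂]
    rcases eq_or_ne j k with rfl | hjk
    · rw [if_pos rfl, if_neg (by omega), if_neg (by omega), facet_of_ne (by omega), tight_self,
        hu1 _ (by omega), hu1 _ (by omega)]
    rw [if_neg hjk, if_neg (show d + j ≠ k by omega), hNℓ]
    rcases eq_or_ne j ℓ with rfl | hjℓ
    · rw [if_pos rfl, if_neg (by omega), hN _ (by omega) (by omega)]
      omega
    rw [if_neg hjℓ, hN j hjk (by omega)]
    rcases eq_or_ne (d + j) ℓ with rfl | hdj
    · rw [if_pos rfl, hexpo j (by omega)]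
      rw [Nat.add_sub_cancel_left] at huℓ
      omega
    · rw [if_neg hdj, hN (d + j) (by omega) (by omega)]
      exact (admissible_expo hum hu3).2 j hj

theorem false_of_exposes_gt (hrej : ∀ v ∈ Subseqs η, ¬ M.AccWord x d (facet d i v))
    (hcut : ∀ v ∈ Subseqs η, M.SegIsCut x G k (expo d v) (v (3 * d + k)))
    (hsame : ∀ v ∈ Subseqs η, M.SameCut x d i k G v) (hiℓ : d + i < ℓ)
    (hℓ : ℓ ≤ 2 * d) (h : ∀ v ∈ Subseqs η, M.Exposes x d i k G v ℓ q) : False := by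
  obtain ⟨v, hv, w, hw, hs, ht⟩ := Subseqs.exists_replace η (3 * (d - 1 - i))
  obtain ⟨e, he1, he2, hr⟩ := h v hv
  obtain ⟨e', he1', he2', hr'⟩ := h w hw
  have hexpo' : ∀ m ≠ i, expo d w m = expo d v m := fun m hm =>
    expo_apply_congr (fun _ => ht _ (by omega) (by omega)) fun _ => ht _ (by omega) (by omega)
  have hpre : ∀ m < k, expo d w m = facet d i v m := fun m hm => by
    rcases eq_or_ne m i with rfl | hmi
    · rw [facet_self, expo_of_lt (by omega), hs, ht _ (by omega) (by omega)]
    · rw [facet_of_ne hmi, tight_of_ne (by omega), hexpo' m hmi]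
  have hck : w (3 * d + k) = v (3 * d + k) := ht _ (by omega) (by omega)
  have hz := (hcut w hw).congr hpre
  rw [hck] at hz
  obtain ⟨hs1, hs2, hs3⟩ := hsame v hv
  rw [← hs1, ← hs2, ← hs3] at hr
  rw [hck, ht (3 * (d - 1 - k) + 2) (by omega) (by omega), ht (3 * (d - 1 - k)) (by omega)
    (by omega), segCut_congr hpre] at hr'
  obtain ⟨u, hu, hu1, hu2⟩ := Subseqs.exists_raise hη hv (3 * d + ℓ) (e + e' + expo d v (ℓ - d))
  have hum := Subseqs.strictMono hη hu
  have hu3 := Subseqs.three_mul_le hη h3 hu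
  have hadm := admissible_tight (d := d) (i := i) hum hu3 (by omega)
  have huℓ := hu2 _ le_rfl
  have hexpo : ∀ m < ℓ, expo d u m = expo d v m := fun m hm =>
    expo_apply_congr (fun _ => hu1 _ (by omega)) fun _ => hu1 _ (by omega)
  have hN : ∀ m, m ≠ i → m ≠ d + i → facet d i u m = expo d u m := fun m h1 h2 => by
    rw [facet_of_ne h1, tight_of_ne h2]
  have htight : tight d i u (d + i) = tight d i v (d + i) := by
    rw [tight_self, tight_self, hu1 _ (by omega), hu1 _ (by omega)]
  have hNi : facet d i u i = facet d i v i := by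
    rw [facet_self, facet_self, hu1 _ (by omega), hu1 _ (by omega)]
  have hNℓ := hN ℓ (by omega) (by omega)
  have hℓ2 : ℓ = 2 * d ∧ e = 1 ∧ e' = 1 ∧ expo d u ℓ = 1 ∨
      ℓ < 2 * d ∧ expo d u ℓ = u (3 * d + ℓ) := by
    rcases hℓ.eq_or_lt with rfl | hℓ
    · rw [tight_of_ne (by omega), expo_two_mul] at he2 he2'
      exact Or.inl ⟨rfl, by omega, by omega, expo_two_mul⟩
    · exact Or.inr ⟨hℓ, expo_of_le (by omega) hℓ⟩
  have hpre' : ∀ m < k, facet d i v m = facet d i u m := fun m hm => by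
    rcases eq_or_ne m i with rfl | hmi
    · exact hNi.symm
    · rw [hN m hmi (by omega), hexpo m (by omega), facet_of_ne hmi, tight_of_ne (by omega)]
  rw [segCut_congr hpre'] at hr hr'
  let N₂ : ℕ → ℕ := fun m => if m = d + i then facet d i v i else
    if m = ℓ then e' + (facet d i u ℓ - e) else facet d i u m
  refine hrej u hu ((accWord_iff_accWord (N₂ := N₂) (g₁ := v (3 * (d - 1 - k)))
    (g₂ := v (3 * (d - 1 - k))) (e₁ := e) (e₂ := e') (ℓ := ℓ) (r := facet d i u ℓ - e)
    (n := v (3 * (d - 1 - k) + 2)) hM (by omega) (by omega)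
    (hz.congr hpre') (fun m hm => ?_) ?_ ?_ ?_ ?_ (q := q) ?_ ?_ ?_ ?_
    fun m h1 h2 => ?_).2 (hacc N₂ ⟨?_, fun j hj => ?_⟩))
  · simp only [N₂]
    rw [if_neg (by omega), if_neg (by omega)]
  · rw [hN k (by omega) (by omega), hexpo k (by omega), expo_of_lt hkd]
  · simp only [N₂]
    rw [if_neg (by omega), if_neg (by omega), hN k (by omega) (by omega), hexpo k (by omega),
      expo_of_lt hkd]
  · exact hG.trans (Subseqs.le_apply hη hv _)
  · exact hG.trans (Subseqs.le_apply hη hv _)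
  · rw [seg_congr (N' := tight d i v)]
    · exact hr
    · intro m h1 h2
      rcases eq_or_ne m (d + i) with rfl | hm
      · rw [facet_of_ne (by omega), htight]
      · rw [hN m (by omega) hm, tight_of_ne hm, hexpo m h2]
  · rw [seg_congr (N' := tight d i w)]
    · exact hr'
    · intro m h1 h2
      simp only [N₂]
      rcases eq_or_ne m (d + i) with rfl | hm
      · rw [if_pos rfl, tight_self, facet_self, hs, ht _ (by omega) (by omega)]
      · rw [if_neg hm, if_neg h2.ne, hN m (by omega) hm, tight_of_ne hm, hexpo m h2,
          hexpo' m (by omega)]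
  · omega
  · simp only [N₂]
    rw [if_neg (by omega), if_pos trivial]
  · simp only [N₂]
    rw [if_neg (by omega), if_neg (by omega)]
  · simp only [N₂]
    rw [if_neg (by omega)]
    split_ifs with h
    · omega
    · rw [hN _ (by omega) (by omega), expo_two_mul]
  · simp only [N₂]
    rw [if_neg (by omega), if_neg (by omega)]
    rcases eq_or_ne j i with rfl | hji
    · rw [if_pos rfl, hNi]
    rw [if_neg (by omega), hN j hji (by omega)]
    rcases eq_or_ne (d + j) ℓ with rfl | hdj
    · rw [if_pos rfl, hexpo j (by omega)]
      rw [Nat.add_sub_cancel_left] at huℓ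
      omega
    · rw [if_neg hdj, hN (d + j) (by omega) (by omega)]
      exact (admissible_expo hum hu3).2 j hj

theorem exists_exposes (hrej : ∀ v ∈ Subseqs η, ¬ M.AccWord x d (facet d i v))
    (hv : v ∈ Subseqs η) (hcut : M.SegIsCut x G k (expo d v) (v (3 * d + k)))
    (hcut' : M.SegIsCut x G k (facet d i v) (v (3 * d + k))) (hsame : M.SameCut x d i k G v) :
    ∃ ℓ q, k < ℓ ∧ ℓ ≤ 2 * d ∧ M.Exposes x d i k G v ℓ q := by
  by_contra! hne
  have hvm := Subseqs.strictMono hη hv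
  have hv3 := Subseqs.three_mul_le hη h3 hv
  have hgG : G ≤ v (3 * (d - 1 - k)) := hG.trans (Subseqs.le_apply hη hv _)
  have hcut0 : M.SegIsCut x G k (tight d i v) (v (3 * d + k)) :=
    hcut.congr fun m hm => (tight_of_ne (by omega)).symm
  have hkeq : tight d i v k = v (3 * d + k) + v (3 * (d - 1 - k)) := by
    rw [tight_of_ne (by omega), expo_of_lt hkd]
  have hA := hacc _ (admissible_tight (d := d) (i := i) hvm hv3 (by omega))
  rw [IsCut.accWord_iff hM (by omega) hcut0 hkeq hgG,
    segCut_congr (N' := expo d v) fun m hm => tight_of_ne (by omega)] at hA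
  refine hrej v hv ?_
  rw [IsCut.accWord_iff hM (by omega) hcut' (by rw [facet_of_ne (by omega), hkeq]) hgG,
    seg_congr (N' := tight d i v) fun m h1 h2 => facet_of_ne (by omega)]
  obtain ⟨hs1, hs2, hs3⟩ := hsame
  rw [hs1, hs2]
  rw [← List.take_append_drop (v (3 * (d - 1 - k) + 2))
    (M.segCut x G k (expo d v) (v (3 * d + k))).2.2] at hA
  rw [← List.take_append_drop (v (3 * (d - 1 - k) + 2))
    (M.segCut x G k (facet d i v) (v (3 * d + k))).2.2, hs3]
  refine hA.congr_stack (fun u t q hut hr => ?_) _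
  have hpos : 0 < v (3 * (d - 1 - k) + 2) := lt_of_le_of_lt (Nat.zero_le _) (hvm (Nat.succ_pos _))
  have hsolid := (hcut.2.2.take hpos).not_reads_nil
  rcases eq_or_ne u [] with rfl | hu
  · exact hsolid 0 q hr
  set y := v (3 * (d - 1 - k)) - (M.segCut x G k (expo d v) (v (3 * d + k))).1
  have hseg : ∀ ℓ, k < ℓ → seg x (Function.update (tight d i v) k y) k ℓ =
      List.replicate y (x k) ++ seg x (tight d i v) (k + 1) ℓ := fun ℓ hℓ => by
    rw [seg_eq_append hℓ, Function.update_self,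
      seg_congr fun m h1 h2 => Function.update_of_ne (by omega) _ _]
  rw [← hseg _ (by omega)] at hut
  obtain ⟨ℓ, e, h1, h2, he1, he2, rfl⟩ := exists_of_append_eq_seg hut.symm hu
  rcases h1.eq_or_lt with rfl | h1
  · rw [seg_self, List.nil_append] at hr
    exact hsolid _ _ hr
  · rw [hseg _ h1] at hr
    rw [Function.update_of_ne h1.ne'] at he2
    exact hne ℓ q h1 (by omega) ⟨e, he1, he2, hr⟩

end

end DPDA

namespace DPDA

variable {Q α Γ : Type} {M : DPDA Q α Γ} {x : ℕ → TSym α} {d i k G : ℕ} {η : ℕ → ℕ}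

theorem exists_segIsCut (hkd : k < d) (hacc : ∀ N, Admissible d N → M.AccWord x d N)
    (hη : StrictMono η) (h3 : ∀ t, 3 * η t ≤ η (t + 1))
    (hrej : ∀ v ∈ Subseqs η, ¬ M.AccWord x d (facet d k v))
    (hG : ∀ X, M.Undecided (x k) ⟨M.q0, X, [M.Z0]⟩ →
      ∃ c₀, ∀ c, c₀ ≤ c → ∃ z, M.IsCut (x k) G X c z) :
    ∃ v ∈ Subseqs η, M.SegIsCut x G k (expo d v) (v (3 * d + k)) := by
  have hv : η ∈ Subseqs η := ⟨id, strictMono_id, rfl⟩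
  have hraise : ∀ r, ∃ w ∈ Subseqs η, (∀ m < k, expo d w m = expo d η m) ∧ r ≤ w (3 * d + k) :=
    fun r => by
      obtain ⟨w, hw, h1, h2⟩ := Subseqs.exists_raise hη hv (3 * d + k) r
      exact ⟨w, hw, fun m hm => expo_apply_congr (fun _ => h1 (3 * d + m) (by omega))
        fun _ => h1 _ (by omega), h2 _ le_rfl⟩
  obtain ⟨c₀, hc₀⟩ := hG _ (undecided_of_accWord (d := d) (N := expo d η) (k := k) (by omega) fun r => by
    obtain ⟨w, hw, h1, h2⟩ := hraise r
    refine ⟨⟨expo d w, h1, ?_, hacc _ (admissible_expo (Subseqs.strictMono hη hw)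
      (Subseqs.three_mul_le hη h3 hw))⟩, facet d k w, fun m hm => ?_, ?_, hrej w hw⟩
    · rw [expo_of_lt hkd]; omega
    · rw [facet_of_ne hm.ne, tight_of_ne (by omega), h1 m hm]
    · rw [facet_self]; omega)
  obtain ⟨w, hw, h1, h2⟩ := hraise c₀
  refine ⟨w, hw, SegIsCut.congr (fun m hm => (h1 m hm).symm) (isCut_cut (hc₀ _ h2))⟩

theorem exists_sameCut [Finite Q] [Finite Γ] (hik : i < k) (hkd : k < d)
    (hcut : ∀ v ∈ Subseqs η, M.SegIsCut x G k (expo d v) (v (3 * d + k))) :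
    ∃ v ∈ Subseqs η, M.SameCut x d i k G v := by
  let h := 3 * (d - 1 - k) + 2
  let S : Set (ℕ × Q × List Γ) := Set.Iic G ×ˢ Set.univ ×ˢ {l | l.length ≤ η h}
  have hS : S.Finite := (Set.finite_Iic G).prod (Set.finite_univ.prod (List.finite_length_le Γ _))
  obtain ⟨u, hu, hlow, hne, hcomb⟩ :=
    Subseqs.exists_combine η (3 * (d - 1 - i)) hS.toFinset.card
  let z : ℕ → ℕ × Q × List Γ := fun y => M.segCut x G k (expo d (u y)) (u 0 (3 * d + k))
  obtain ⟨a, ha, b, hb, hab, hF⟩ := Finset.exists_ne_map_eq_of_card_lt_of_maps_to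
    (s := Finset.range (hS.toFinset.card + 1)) (t := hS.toFinset) (by simp)
    (f := fun y => ((z y).1, (z y).2.1, (z y).2.2.take (η h))) (fun y hy => by
      have hy' : y ≤ hS.toFinset.card := by
        have := Finset.mem_coe.1 hy
        rw [Finset.mem_range] at this
        omega
      have := (hcut _ (hu y hy')).1
      rw [hne y 0 _ (by omega)] at this
      simpa [S] using this)
  wlog hlt : a < b generalizing a b
  · exact this b hb a ha hab.symm hF.symm (by omega)
  simp only [Prod.mk.injEq] at hF
  obtain ⟨w, hw, hw1, hw2, hw3⟩ := hcomb a b hlt (by rw [Finset.mem_range] at hb; omega)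
  have hwa : ∀ m < k, expo d w m = expo d (u a) m := fun m hm =>
    expo_apply_congr (fun _ => hw3 _ (by omega) (by omega)) fun _ => by
      rcases eq_or_ne m i with rfl | hmi
      · exact hw1
      · exact hw3 _ (by omega) (by omega)
  have hwb : ∀ m < k, facet d i w m = expo d (u b) m := fun m hm => by
    rcases eq_or_ne m i with rfl | hmi
    · rw [facet_self, expo_of_lt (by omega), hw2, hw3 _ (by omega) (by omega),
        hne a b _ (by omega)]
    · rw [facet_of_ne hmi, tight_of_ne (by omega), hwa m hm]
      exact expo_apply_congr (fun _ => hne _ _ _ (by omega)) fun _ => hne _ _ _ (by omega)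
  have hwh : w h = η h := by
    rw [hw3 _ (by omega) (by omega), hlow _ _ (by omega)]
  have hwc : w (3 * d + k) = u 0 (3 * d + k) := by
    rw [hw3 _ (by omega) (by omega), hne a 0 _ (by omega)]
  refine ⟨w, hw, ?_⟩
  rw [SameCut, segCut_congr hwa, segCut_congr hwb, hwc, hwh]
  exact ⟨hF.1.symm, hF.2.1.symm, hF.2.2.symm⟩

/-- No machine accepts all words of `Lle d` and none of the words violating a single one of two
of the inequalities. -/
theorem false_of_two_facets [Finite Q] [Finite Γ] (hM : M.Valid) (hik : i < k) (hkd : k < d)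
    (hacc : ∀ N, Admissible d N → M.AccWord x d N)
    (hη : StrictMono η) (h3 : ∀ t, 3 * η t ≤ η (t + 1))
    (hi : ∀ v ∈ Subseqs η, ¬ M.AccWord x d (facet d i v))
    (hk : ∀ v ∈ Subseqs η, ¬ M.AccWord x d (facet d k v)) : False := by
  obtain ⟨G, hG⟩ := exists_isCut hM (x k)
  let f : (ℕ → ℕ) → Prop × Prop × (Fin (2 * d + 1) → Q → Prop) := fun v =>
    (M.SegIsCut x G k (expo d v) (v (3 * d + k)), M.SameCut x d i k G v,
      fun ℓ q => M.Exposes x d i k G v ℓ q)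
  have hf : ∀ v w : ℕ → ℕ, (∀ t < 5 * d, v t = w t) → f v = f w := fun v w h => by
    have h1 : expo d v = expo d w := expo_congr h
    have h2 : tight d i v = tight d i w := tight_congr (by omega) h
    have h3 : facet d i v = facet d i w := by
      rw [facet, facet, h2, h _ (by omega), h _ (by omega)]
    simp only [f, SameCut, Exposes, h1, h2, h3, h (3 * d + k) (by omega),
      h (3 * (d - 1 - k)) (by omega), h (3 * (d - 1 - k) + 2) (by omega)]
  let τ : ℕ → ℕ := fun t => t + G
  have hτ : StrictMono τ := fun a b hab => by simpa [τ] using hab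
  obtain ⟨θ, hθ, κ, hκ⟩ := exists_homogeneous_subseq (5 * d) (fun v => f (η ∘ τ ∘ v))
    fun v w h => hf _ _ fun t ht => by simp [h t ht]
  obtain ⟨μ, hμ⟩ : ∃ μ, μ = η ∘ τ ∘ θ := ⟨_, rfl⟩
  have hsub : Subseqs μ ⊆ Subseqs η := hμ ▸ Subseqs.comp_subset (hτ.comp hθ)
  have hself : μ ∈ Subseqs μ := ⟨id, strictMono_id, rfl⟩
  have hμm := Subseqs.strictMono hη (hsub hself)
  have hμ3 := Subseqs.three_mul_le hη h3 (hsub hself)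
  have hμG : G ≤ μ 0 := by
    rw [hμ]
    exact (Nat.le_add_left G _).trans hη.le_apply
  have hfκ : ∀ v ∈ Subseqs μ, ∀ w ∈ Subseqs μ, f v = f w := by
    rintro _ ⟨σ, hσ, rfl⟩ _ ⟨ρ, hρ, rfl⟩
    rw [hμ]
    exact (hκ σ hσ).trans (hκ ρ hρ).symm
  have hiμ := fun v hv => hi v (hsub hv)
  have hkμ := fun v hv => hk v (hsub hv)
  have hcut : ∀ v ∈ Subseqs μ, M.SegIsCut x G k (expo d v) (v (3 * d + k)) := fun v hv => by
    obtain ⟨w, hw, h⟩ := exists_segIsCut hkd hacc hμm hμ3 hkμ hG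
    exact (congrArg Prod.fst (hfκ v hv w hw)).mpr h
  have hsame : ∀ v ∈ Subseqs μ, M.SameCut x d i k G v := fun v hv => by
    obtain ⟨w, hw, h⟩ := exists_sameCut hik hkd hcut
    exact (congrArg (fun c => c.2.1) (hfκ v hv w hw)).mpr h
  have hexp : ∀ v ∈ Subseqs μ, ∀ w ∈ Subseqs μ, ∀ ℓ q, ℓ ≤ 2 * d →
      M.Exposes x d i k G v ℓ q → M.Exposes x d i k G w ℓ q := fun v hv w hw ℓ q hℓ h =>
    (congrArg (fun c => c.2.2 ⟨ℓ, by omega⟩ q) (hfκ v hv w hw)).mp h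
  obtain ⟨v, hv, w, hw, hs, ht⟩ := Subseqs.exists_replace μ (3 * (d - 1 - i))
  have hcut' : M.SegIsCut x G k (facet d i v) (v (3 * d + k)) := by
    rw [← ht (3 * d + k) (by omega) (by omega)]
    refine (hcut w hw).congr fun m hm => ?_
    rcases eq_or_ne m i with rfl | hmi
    · rw [facet_self, expo_of_lt (by omega), hs, ht _ (by omega) (by omega)]
    · rw [facet_of_ne hmi, tight_of_ne (by omega)]
      exact expo_apply_congr (fun _ => ht _ (by omega) (by omega))
        fun _ => ht _ (by omega) (by omega)
  obtain ⟨ℓ, q, hkℓ, hℓ, h⟩ := exists_exposes hM hik hkd hacc hμm hμ3 hμG hiμ hv (hcut v hv) hcut'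
    (hsame v hv)
  have hall : ∀ w ∈ Subseqs μ, M.Exposes x d i k G w ℓ q := fun w hw =>
    hexp v hv w hw ℓ q hℓ h
  rcases le_or_gt ℓ (d + i) with hℓi | hℓi
  · exact false_of_exposes_le hM hik hkd hacc hμm hμ3 hμG hkμ hcut hkℓ hℓi hall
  · exact false_of_exposes_gt hM hik hkd hacc hμm hμ3 hμG hiμ hcut hsame hℓi hℓ hall

end DPDA

instance {α β : Type*} [BEq α] [BEq β] [LawfulBEq α] [LawfulBEq β] : LawfulBEq (α ⊕ β) where
  rfl {a} := by
    rcases a with a | a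
    · exact beq_self_eq_true (a : α)
    · exact beq_self_eq_true (a : β)
  eq_of_beq {a b} h := by
    rcases a with a | a <;> rcases b with b | b
    · exact congrArg Sum.inl (eq_of_beq h)
    · cases h
    · cases h
    · exact congrArg Sum.inr (eq_of_beq h)

/-- The word `a₁^{n₁} ⋯ a_d^{n_d} b₁^{m₁} ⋯ b_d^{m_d}`. -/
def blockWord {d : ℕ} (n m : Fin d → ℕ) : List (Fin d ⊕ Fin d) :=
  (List.ofFn fun i => List.replicate (n i) (Sum.inl i : Fin d ⊕ Fin d)).flatten ++
    (List.ofFn fun i => List.replicate (m i) (Sum.inr i : Fin d ⊕ Fin d)).flatten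

/-- The position of a letter in the order `a₁, …, a_d, b₁, …, b_d`. -/
def letterIdx {d : ℕ} : Fin d ⊕ Fin d → Fin (2 * d) :=
  Sum.elim (fun i => ⟨i, by omega⟩) fun i => ⟨d + i, by omega⟩

section blockWord

variable {d : ℕ} {n m : Fin d → ℕ}

theorem letterIdx_injective : Function.Injective (letterIdx (d := d)) := by
  rintro (i | i) (j | j) h <;> simp only [letterIdx, Sum.elim_inl, Sum.elim_inr, Fin.mk.injEq] at h
  · rw [Fin.ext h]
  · omega
  · omega
  · rw [Fin.ext (Nat.add_left_cancel h)]

theorem count_inl_blockWord (i : Fin d) : (blockWord n m).count (Sum.inl i) = n i := by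
  simp [blockWord, List.count_flatten, List.map_ofFn, List.sum_ofFn, List.count_replicate]

theorem count_inr_blockWord (i : Fin d) : (blockWord n m).count (Sum.inr i) = m i := by
  simp [blockWord, List.count_flatten, List.map_ofFn, List.sum_ofFn, List.count_replicate]

theorem pairwise_blockWord :
    (blockWord n m).Pairwise fun a b => letterIdx a ≤ letterIdx b := by
  simp only [blockWord, List.pairwise_append, List.pairwise_flatten, List.pairwise_ofFn,
    List.mem_ofFn, List.mem_flatten, forall_exists_index, forall_apply_eq_imp_iff, and_imp,
    List.mem_replicate, List.pairwise_replicate]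
  refine ⟨⟨fun i => Or.inr le_rfl, fun i j hij => ?_⟩, ⟨fun i => Or.inr le_rfl, fun i j hij => ?_⟩, ?_⟩
  · rintro _ - rfl _ - rfl
    exact hij.le
  · rintro _ - rfl _ - rfl
    exact Nat.add_le_add_left hij.le _
  · rintro _ i - rfl _ j - rfl
    exact i.2.le.trans (Nat.le_add_right _ _)

theorem mem_Lle_iff {s : List (Fin d ⊕ Fin d)} :
    s ∈ Lle d ↔ (s.Pairwise fun a b => letterIdx a ≤ letterIdx b) ∧
      ∀ i : Fin d, s.count (Sum.inl i) ≤ s.count (Sum.inr i) := by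
  constructor
  · rintro ⟨n, m, h, rfl⟩
    refine ⟨pairwise_blockWord, fun i => ?_⟩
    exact (count_inl_blockWord i).trans_le ((h i).trans_eq (count_inr_blockWord i).symm)
  · rintro ⟨h1, h2⟩
    refine ⟨fun i => s.count (Sum.inl i), fun i => s.count (Sum.inr i), h2, ?_⟩
    have hc : ∀ a, s.count a = (blockWord (fun i => s.count (Sum.inl i)) fun i =>
        s.count (Sum.inr i)).count a := by
      rintro (i | i)
      · rw [count_inl_blockWord]
      · rw [count_inr_blockWord]
    exact List.Perm.eq_of_pairwise (fun a b _ _ h h' => letterIdx_injective (le_antisymm h h')) h1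
      pairwise_blockWord ((@List.perm_iff_count _ Sum.instBEq _ _ _).2 hc)

theorem blockWord_mem_Lle : blockWord n m ∈ Lle d ↔ ∀ i, n i ≤ m i := by
  simp [mem_Lle_iff, pairwise_blockWord, count_inl_blockWord, count_inr_blockWord]

/-- The tape symbols `a₁, …, a_d, b₁, …, b_d, $`. -/
def tapeLetter (d ℓ : ℕ) : TSym (Fin d ⊕ Fin d) :=
  if h : ℓ < d then TSym.ch (Sum.inl ⟨ℓ, h⟩)
  else if h : ℓ < 2 * d then TSym.ch (Sum.inr ⟨ℓ - d, by omega⟩) else TSym.rend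

theorem seg_eq_map {β γ : Type*} {x : ℕ → β} {N : ℕ → ℕ} {lo : ℕ} {f : Fin d → γ} {g : γ → β}
    (h : ∀ i : Fin d, x (lo + i) = g (f i)) :
    seg x N lo (lo + d) = (List.ofFn fun i => List.replicate (N (lo + i)) (f i)).flatten.map g := by
  have : List.range' lo d = List.ofFn fun i : Fin d => lo + (i : ℕ) := by
    apply List.ext_getElem <;> simp
  rw [seg, Nat.add_sub_cancel_left, this, List.map_flatten, List.map_ofFn, List.flatMap,
    List.map_ofFn]
  congr 2
  funext i
  simp [h]

theorem tape_blockWord {N : ℕ → ℕ} (hN : N (2 * d) = 1) :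
    DPDA.tape (blockWord (fun i : Fin d => N i) fun i => N (d + i)) =
      TSym.lend :: seg (tapeLetter d) N 0 (2 * d + 1) := by
  have h1 := seg_eq_map (d := d) (x := tapeLetter d) (N := N) (lo := 0) (f := Sum.inl)
      (g := TSym.ch) fun i => by simp [tapeLetter]
  simp only [Nat.zero_add] at h1
  have h2 := seg_eq_map (d := d) (x := tapeLetter d) (N := N) (lo := d) (f := Sum.inr)
      (g := TSym.ch) fun i => by simp [tapeLetter, two_mul]
  have h3 : seg (tapeLetter d) N (2 * d) (2 * d + 1) = [TSym.rend] := by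
    rw [seg_eq_append (Nat.lt_succ_self _), hN, seg_self]
    simp [tapeLetter, two_mul]
  rw [← seg_append (Nat.zero_le (2 * d)) (Nat.le_succ _), ← seg_append (Nat.zero_le d)
    (show d ≤ 2 * d by omega), h3, h1, two_mul, h2, DPDA.tape, blockWord]
  simp [List.map_append, List.map_flatten, List.map_ofFn, Function.comp_def]

theorem accepts_blockWord_iff {Q Γ : Type} {M : DPDA Q (Fin d ⊕ Fin d) Γ} {N : ℕ → ℕ}
    (hN : N (2 * d) = 1) :
    M.Accepts (blockWord (fun i : Fin d => N i) fun i => N (d + i)) ↔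
      M.AccWord (tapeLetter d) d N := by
  rw [DPDA.Accepts, DPDA.init, tape_blockWord hN]
  rfl

end blockWord

theorem not_DCFLInter_pred_Lle {d : ℕ} (hd : 1 ≤ d) : ¬ DCFLInter (d - 1) (Lle d) := by
  rintro ⟨f, hf, hL⟩
  choose Q Γ hQ hΓ M hM _ hlang using hf
  have hmem : ∀ N : ℕ → ℕ, N (2 * d) = 1 →
      ((∀ i : Fin d, N i ≤ N (d + i)) ↔ ∀ κ, (M κ).AccWord (tapeLetter d) d N) := fun N hN => by
    rw [← blockWord_mem_Lle, hL, Set.mem_iInter]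
    refine forall_congr' fun κ => ?_
    rw [hlang, ← accepts_blockWord_iff hN]
    rfl
  have hacc : ∀ κ N, Admissible d N → (M κ).AccWord (tapeLetter d) d N := fun κ N hN =>
    (hmem N hN.1).1 (fun i => hN.2 i i.2) κ
  let η₀ : ℕ → ℕ := fun t => 3 ^ t
  have hη₀ : StrictMono η₀ := pow_right_strictMono₀ (by norm_num)
  have h3 : ∀ t, 3 * η₀ t ≤ η₀ (t + 1) := fun t => (pow_succ' 3 t).ge
  have hrej : ∀ v ∈ Subseqs η₀, ∀ i : Fin d, ∃ κ, ¬ (M κ).AccWord (tapeLetter d) d (facet d i v) := by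
    intro v hv i
    by_contra! h
    have hid := i.2
    have := (hmem _ (by rw [facet_of_ne (by omega), tight_of_ne (by omega), expo_two_mul])).2 h i
    rw [facet_self, facet_of_ne (by omega), tight_self] at this
    have := Subseqs.strictMono hη₀ hv (Nat.lt_add_one (3 * (d - 1 - i)))
    omega
  obtain ⟨θ, hθ, κ, hκ⟩ := exists_homogeneous_subseq (5 * d)
    (fun (v : ℕ → ℕ) (κ : Fin (d - 1)) (i : Fin d) =>
      (M κ).AccWord (tapeLetter d) d (facet d i (η₀ ∘ v))) fun v w h => by
    funext κ i
    have hid := i.2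
    rw [facet, facet, tight_congr (v := η₀ ∘ v) (w := η₀ ∘ w) i.2 fun t ht => congrArg η₀ (h t ht)]
    simp only [Function.comp, h (3 * d + i) (by omega), h (3 * (d - 1 - i) + 1) (by omega)]
  have hconst : ∀ v ∈ Subseqs (η₀ ∘ θ), ∀ (c : Fin (d - 1)) (i : Fin d),
      (M c).AccWord (tapeLetter d) d (facet d i v) = κ c i := by
    rintro _ ⟨σ, hσ, rfl⟩ c i
    exact congrFun (congrFun (hκ σ hσ) c) i
  have hself : η₀ ∘ θ ∈ Subseqs (η₀ ∘ θ) := ⟨id, strictMono_id, rfl⟩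
  choose g hg using hrej _ (Subseqs.comp_subset hθ hself)
  have hg' : ∀ i, ∀ v ∈ Subseqs (η₀ ∘ θ), ¬ (M (g i)).AccWord (tapeLetter d) d (facet d i v) :=
    fun i v hv => by
      rw [hconst v hv, ← hconst _ hself]
      exact hg i
  obtain ⟨i, k, hik, hgik⟩ : ∃ i k : Fin d, i < k ∧ g i = g k := by
    obtain ⟨i, k, hne, h⟩ := Fintype.exists_ne_map_eq_of_card_lt g (by simp; omega)
    rcases hne.lt_or_gt with h' | h'
    · exact ⟨i, k, h', h⟩
    · exact ⟨k, i, h', h.symm⟩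
  refine DPDA.false_of_two_facets (hM (g k)) hik k.2 (hacc _) (hη₀.comp hθ) (fun t => ?_)
    (hgik ▸ hg' i) (hg' k)
  exact (h3 _).trans (hη₀.monotone (hθ (Nat.lt_succ_self t)))

namespace DPDA

theorem Valid.not_accFrom_of_mem_Rej {Q α Γ : Type} {M : DPDA Q α Γ} (hM : M.Valid)
    {c : Cfg Q α Γ} (h : c.st ∈ M.Rej) : ¬ M.AccFrom c := by
  rintro ⟨_ | n, e, hn, he⟩
  · simp only [stepN, Option.some.injEq] at hn
    subst hn
    exact hM.1 _ he h
  · have hδ := hM.2.1 c.st (Or.inr h)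
    have : M.step c = none := by
      rcases c with ⟨p, _ | ⟨t, rest⟩, _ | ⟨a, s⟩⟩ <;> simp_all [step]
    simp [stepN, this] at hn

/-- The action of a letter on the top stack symbol of `counter i`: `a_i` pushes a mark `true`, and
`b_i` pops one if there is one; `false` is the bottom marker. -/
def counterStack {d : ℕ} (i : Fin d) (c : Fin d ⊕ Fin d) (a : Bool) : List Bool :=
  if c = Sum.inl i then [true, a] else if c = Sum.inr i ∧ a = true then [] else [a]

/-- The automaton that checks the order of the letters, remembering the position of the last one,
and compares the numbers of `a_i` and `b_i` on its stack.  The states `Sum.inl true` and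
`Sum.inl false` are the accepting and the rejecting state. -/
def counter {d : ℕ} (i : Fin d) :
    DPDA (Bool ⊕ WithBot (Fin (2 * d))) (Fin d ⊕ Fin d) Bool where
  δ
    | Sum.inr p, some TSym.lend, a => some (Sum.inr p, [a])
    | Sum.inr _, some TSym.rend, a => some (Sum.inl !a, [a])
    | Sum.inr p, some (TSym.ch c), a =>
      if p ≤ letterIdx c then some (Sum.inr (letterIdx c), counterStack i c a)
      else some (Sum.inl false, [a])
    | _, _, _ => none
  q0 := Sum.inr ⊥
  Z0 := false
  Acc := {Sum.inl true}
  Rej := {Sum.inl false}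

variable {d : ℕ} {i : Fin d}

theorem valid_counter : (counter i).Valid := by
  refine ⟨by simp [counter], ?_, ?_, ?_⟩
  · rintro (_ | _) h σ a
    · rfl
    · simp [IsHalting, counter] at h
  · rintro (_ | _ | _) h (_ | _ | _) a <;> simp [IsHalting, counter] at h ⊢ <;> split_ifs <;> rfl
  · rintro (_ | p) (_ | _ | _ | _) q w h <;> simp only [counter, counterStack] at h <;> grind

theorem counter_verdict (w : List (Fin d ⊕ Fin d)) (p : WithBot (Fin (2 * d))) (k : ℕ) :
    ∃ n c b, (counter i).stepN n
      ⟨Sum.inr p, w.map TSym.ch ++ [TSym.rend], List.replicate k true ++ [false]⟩ = some c ∧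
      c.st = Sum.inl b ∧ (b = true ↔ (∀ a ∈ w, p ≤ letterIdx a) ∧
        (w.Pairwise fun a b => letterIdx a ≤ letterIdx b) ∧
        k + w.count (Sum.inl i) ≤ w.count (Sum.inr i)) := by
  induction w generalizing p k with
  | nil =>
    cases k with
    | zero => exact ⟨1, _, true, rfl, rfl, by simp⟩
    | succ k => exact ⟨1, _, false, rfl, rfl, by simp⟩
  | cons x w ih =>
    obtain ⟨a, s, hs⟩ : ∃ a s, List.replicate k true ++ [false] = a :: s := by
      cases k <;> exact ⟨_, _, rfl⟩
    by_cases hp : p ≤ letterIdx x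
    · obtain ⟨k', hk', hcount⟩ : ∃ k', counterStack i x a ++ s = List.replicate k' true ++ [false] ∧
          ((∀ y ∈ w, letterIdx x ≤ letterIdx y) →
            (k' + w.count (Sum.inl i) ≤ w.count (Sum.inr i) ↔
              k + (x :: w).count (Sum.inl i) ≤ (x :: w).count (Sum.inr i))) := by
        rw [counterStack]
        split_ifs with h1 h2
        · subst h1
          refine ⟨k + 1, by simp [← hs, List.replicate_succ], fun _ => ?_⟩
          simp
          omega
        · obtain ⟨rfl, rfl⟩ := h2
          obtain ⟨k, rfl⟩ : ∃ m, k = m + 1 := by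
            cases k with
            | zero => simp at hs
            | succ m => exact ⟨m, rfl⟩
          refine ⟨k, ?_, fun _ => ?_⟩
          · simpa [List.replicate_succ] using hs.symm
          · simp
            omega
        · refine ⟨k, by simp [hs], fun hw => ?_⟩
          rw [List.count_cons_of_ne h1]
          by_cases h3 : x = Sum.inr i
          · subst h3
            have hk : k = 0 := by
              cases k with
              | zero => rfl
              | succ m => simp [List.replicate_succ] at hs; simp [← hs.1] at h2
            have : w.count (Sum.inl i) = 0 := by
              refine List.count_eq_zero.2 fun h => ?_
              have hle := Fin.le_def.1 (hw _ h)
              have hi := i.2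
              simp only [letterIdx, Sum.elim_inl, Sum.elim_inr] at hle
              omega
            simp [hk, this]
          · rw [List.count_cons_of_ne h3]
      obtain ⟨n, c, b, hn, hc, hb⟩ := ih (letterIdx x) k'
      refine ⟨n + 1, c, b, ?_, hc, hb.trans ?_⟩
      · have : (counter i).step ⟨Sum.inr p, (x :: w).map TSym.ch ++ [TSym.rend], a :: s⟩ =
            some ⟨Sum.inr (letterIdx x), w.map TSym.ch ++ [TSym.rend],
              counterStack i x a ++ s⟩ := by
          simp [step, counter, hp]
        rw [hs, stepN, this, hk']
        exact hn
      · simp only [List.pairwise_cons, List.forall_mem_cons, WithBot.coe_le_coe]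
        constructor
        · rintro ⟨h1, h2, h3⟩
          exact ⟨⟨hp, fun y hy => hp.trans (WithBot.coe_le_coe.2 (h1 y hy))⟩, ⟨h1, h2⟩,
            (hcount h1).1 h3⟩
        · rintro ⟨-, ⟨h1, h2⟩, h3⟩
          exact ⟨h1, h2, (hcount h1).2 h3⟩
    · refine ⟨1, ⟨Sum.inl false, w.map TSym.ch ++ [TSym.rend], a :: s⟩, false, ?_, rfl, ?_⟩
      · simp [hs, stepN, step, counter, hp]
      · simp [hp]

theorem counter_verdict_init (w : List (Fin d ⊕ Fin d)) :
    ∃ n c b, (counter i).stepN n ((counter i).init w) = some c ∧ c.st = Sum.inl b ∧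
      (b = true ↔ (w.Pairwise fun a b => letterIdx a ≤ letterIdx b) ∧
        w.count (Sum.inl i) ≤ w.count (Sum.inr i)) := by
  obtain ⟨n, c, b, hn, hc, hb⟩ := counter_verdict (i := i) w ⊥ 0
  exact ⟨n + 1, c, b, hn, hc, by simpa using hb⟩

theorem haltsOnAll_counter : (counter i).HaltsOnAll := fun w => by
  obtain ⟨n, c, b, hn, hc, -⟩ := counter_verdict_init (i := i) w
  refine ⟨n, c, hn, ?_⟩
  cases b <;> simp [IsHalting, counter, hc]

theorem mem_lang_counter {w : List (Fin d ⊕ Fin d)} :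
    w ∈ (counter i).lang ↔ (w.Pairwise fun a b => letterIdx a ≤ letterIdx b) ∧
      w.count (Sum.inl i) ≤ w.count (Sum.inr i) := by
  obtain ⟨n, c, b, hn, hc, hb⟩ := counter_verdict_init (i := i) w
  rw [← hb]
  refine (valid_counter.accFrom_stepN_iff hn).trans ?_
  cases b with
  | false =>
    exact iff_of_false (valid_counter.not_accFrom_of_mem_Rej (by simp [counter, hc])) (by simp)
  | true => exact iff_of_true ⟨0, c, rfl, by simp [counter, hc]⟩ rfl

end DPDA

theorem DCFLInter_Lle {d : ℕ} (hd : 1 ≤ d) : DCFLInter d (Lle d) := by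
  refine ⟨fun i => (DPDA.counter i).lang, fun i => ⟨_, _, inferInstance, inferInstance,
    DPDA.counter i, DPDA.valid_counter, DPDA.haltsOnAll_counter, rfl⟩, ?_⟩
  ext w
  simp only [mem_Lle_iff, Set.mem_iInter, DPDA.mem_lang_counter]
  exact ⟨fun h i => ⟨h.1, h.2 i⟩, fun h => ⟨(h ⟨0, hd⟩).1, fun i => (h i).2⟩⟩

/-- `L_d^(≤)` belongs to `DCFL(d)` but not to `DCFL(d−1)`. -/
theorem Lle_in_DCFLInter_d_not_in_DCFLInter_pred (d : ℕ) (hd : 2 ≤ d) :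
    DCFLInter d (Lle d) ∧ ¬ DCFLInter (d - 1) (Lle d) := by
  exact ⟨DCFLInter_Lle (by omega), not_DCFLInter_pred_Lle (by omega)⟩

end DCFLFormal
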